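/- Let H be a closed subgroup of the Euclidean isometry group ℝⁿ ⋊ O(n). Then the group of components H/H° is {free abelian of rank ≤ n}-by-finite, i.e., H/H° has a normal subgroup isomorphic to ℤᵐ with m ≤ n of finite index. -/

import Mathlib

/-- The isometry group of Euclidean `n`-space (which is `ℝⁿ ⋊ O(n)`). -/
abbrev EuclideanIsomGroup (n : ℕ) :=
  EuclideanSpace ℝ (Fin n) ≃ᵢ EuclideanSpace ℝ (Fin n)

/-- The natural (Lie group) topology on the Euclidean isometry group: the topology of
pointwise convergence. -/
noncomputable instance (n : ℕ) : TopologicalSpace (EuclideanIsomGroup n) :=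
  TopologicalSpace.induced (fun f => (f : EuclideanSpace ℝ (Fin n) → EuclideanSpace ℝ (Fin n)))
    Pi.topologicalSpace

open Topology Filter
open scoped commutatorElement

section Linear

variable {D : Type*} [NormedAddCommGroup D] [InnerProductSpace ℝ D]

/-- A linear isometry fixing `Au - u` fixes `u`. -/
lemma isometry_fixed_of_fixed_sub {A : D →L[ℝ] D} (hA : ∀ v, ‖A v‖ = ‖v‖) {u : D}
    (h : A (A u - u) = A u - u) : A u = u := by
  have hs : ‖A (A u) - A u‖ = ‖A u - u‖ := by rw [← map_sub, hA]
  have h2 : A (A u) = A u + (A u - u) := by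
    rw [map_sub] at h; rw [← h]; abel
  have e1 : ‖A u + (A u - u)‖ = ‖u‖ := by rw [← h2, hA, hA]
  have e2 : ‖A u - (A u - u)‖ = ‖u‖ := by simp
  have e3 := parallelogram_law_with_norm ℝ (A u) (A u - u)
  rw [e1, e2, hA] at e3
  have : ‖A u - u‖ = 0 := by nlinarith [norm_nonneg (A u - u)]
  exact sub_eq_zero.1 (norm_eq_zero.1 this)

/-- A linear isometry all of whose powers stay within distance `1/2` of the identity is the
identity. -/
lemma isometry_eq_one_of_forall_pow_near {C : D →L[ℝ] D} (hC : ∀ v, ‖C v‖ = ‖v‖)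
    (h : ∀ k : ℕ, ∀ v, ‖(C ^ k) v - v‖ ≤ 1 / 2 * ‖v‖) : C = 1 := by
  have hCk : ∀ k : ℕ, ∀ v, ‖(C ^ k) v‖ = ‖v‖ := by
    intro k
    induction k with
    | zero => simp
    | succ k ih => intro v; rw [pow_succ, mul_apply_eq_comp, ih, hC]
  ext w
  change C w = w
  set v := C w - w with hv
  have tel : ∀ m : ℕ, ∑ k ∈ Finset.range m, (C ^ k) v = (C ^ m) w - w := by
    intro m
    induction m with
    | zero => simp
    | succ m ih =>
      rw [Finset.sum_range_succ, ih, hv, map_sub, pow_succ, mul_apply_eq_comp]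
      abel
  have key : ∀ m : ℕ, (m : ℝ) * ‖v‖ ≤ 4 * ‖w‖ := by
    intro m
    have h1 : ‖∑ k ∈ Finset.range m, ((C ^ k) v - v)‖ ≤ m * (1 / 2 * ‖v‖) := by
      refine (norm_sum_le_of_le _ (fun k _ => h k v)).trans ?_
      simp
    rw [Finset.sum_sub_distrib, tel] at h1
    simp only [Finset.sum_const, Finset.card_range] at h1
    have h2 : ‖(m : ℕ) • v‖ ≤ ‖(C ^ m) w - w - m • v‖ + ‖(C ^ m) w - w‖ := by
      have := norm_sub_le ((C ^ m) w - w) ((C ^ m) w - w - m • v)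
      simp only [sub_sub_cancel] at this
      linarith
    have h3 : ‖(C ^ m) w - w‖ ≤ 2 * ‖w‖ := by
      have := norm_sub_le ((C ^ m) w) w
      rw [hCk] at this; linarith
    rw [← Nat.cast_smul_eq_nsmul ℝ, norm_smul] at h2
    simp only [Real.norm_natCast] at h2
    rw [← Nat.cast_smul_eq_nsmul ℝ] at h1
    linarith
  by_contra hne
  have hpos : 0 < ‖v‖ := norm_pos_iff.2 (sub_ne_zero.2 hne)
  obtain ⟨m, hm⟩ := exists_nat_gt (4 * ‖w‖ / ‖v‖)
  rw [div_lt_iff₀ hpos] at hm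
  linarith [key m]

end Linear

section Group

variable {Q : Type*} [Group Q] {D : Type*} [NormedAddCommGroup D] [InnerProductSpace ℝ D]
  (β : Q →* (D →L[ℝ] D)) (hβ : ∀ q v, ‖β q v‖ = ‖v‖)

include hβ in
lemma commute_of_commute_commutator {a b : Q} (hb : ∀ v, ‖β b v - v‖ ≤ 1 / 4 * ‖v‖)
    (h : Commute (β a) (β ⁅a, b⁆)) : Commute (β a) (β b) := by
  have hmul : ∀ (x y : Q) v, β (x * y) v = β x (β y v) := by intro x y v; simp
  have hconj : ∀ k : ℕ, β (a ^ k * b) = β (⁅a, b⁆ ^ k * b * a ^ k) := by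
    intro k
    induction k with
    | zero => simp
    | succ k ih =>
      have hk : Commute (β a) (β (⁅a, b⁆ ^ k)) := by
        rw [map_pow]; exact h.pow_right k
      calc β (a ^ (k + 1) * b) = β a * β (a ^ k * b) := by rw [pow_succ', mul_assoc, map_mul]
        _ = β a * β (⁅a, b⁆ ^ k) * β (b * a ^ k) := by
            rw [ih, mul_assoc (_ ^ k), map_mul, mul_assoc]
        _ = β (⁅a, b⁆ ^ k * (a * b * a ^ k)) := by
            rw [hk.eq]; simp only [map_mul, mul_assoc]
        _ = _ := by
            congr 1
            rw [pow_succ ⁅a, b⁆, pow_succ' a]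
            simp only [commutatorElement_def]; group
  have hC : β ⁅a, b⁆ = 1 := by
    refine isometry_eq_one_of_forall_pow_near (hβ _) fun k v => ?_
    obtain ⟨w, rfl⟩ : ∃ w, v = β (b * a ^ k) w :=
      ⟨β (b * a ^ k)⁻¹ v, by rw [← hmul]; simp⟩
    have h1 : β (⁅a, b⁆ ^ k) (β (b * a ^ k) w) = β (a ^ k) (β b w) := by
      rw [← hmul, ← hmul, hconj k, mul_assoc]
    rw [← map_pow, h1, hβ, hmul]
    have e : β (a ^ k) (β b w) - β b (β (a ^ k) w)
        = β (a ^ k) (β b w - w) - (β b (β (a ^ k) w) - β (a ^ k) w) := by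
      rw [map_sub]; abel
    have h2 := hb w
    have h3 := hb (β (a ^ k) w)
    have h4 := norm_sub_le (β (a ^ k) (β b w - w)) (β b (β (a ^ k) w) - β (a ^ k) w)
    rw [hβ] at h3 h4
    rw [e]; linarith
  have : β (a * b) = β (⁅a, b⁆ * (b * a)) := by
    congr 1; simp only [commutatorElement_def]; group
  rw [map_mul, map_mul, hC, one_mul, map_mul] at this
  exact this

/-- Iterated commutators `[a,[a,…,[a,b]]]`. -/
def iteratedCommutator (a b : Q) : ℕ → Q
  | 0 => b
  | k + 1 => ⁅a, iteratedCommutator a b k⁆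

variable (σ : Q → D) (hσ : ∀ p q, σ (p * q) = σ p + β p (σ q))

include hσ in
lemma cocycle_one : σ 1 = 0 := by simpa using hσ 1 1

include hσ in
lemma cocycle_commutator (a b : Q) :
    σ ⁅a, b⁆ = (σ a - β (a * b * a⁻¹) (σ a)) + (β a (σ b) - β ⁅a, b⁆ (σ b)) := by
  have h1 := hσ ⁅a, b⁆ (b * a)
  have h2 : ⁅a, b⁆ * (b * a) = a * b := by simp only [commutatorElement_def]; group
  have h3 : β (a * b * a⁻¹) (σ a) = β ⁅a, b⁆ (β b (σ a)) := by
    rw [← mul_apply_eq_comp, ← map_mul]; congr 2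
    simp only [commutatorElement_def]; group
  rw [h2, hσ a b, hσ b a, map_add] at h1
  rw [h3]
  rw [← sub_eq_iff_eq_add] at h1
  rw [← h1]; abel

include hβ in
lemma norm_conj_sub (a b : Q) {r : ℝ} (hb : ∀ v, ‖β b v - v‖ ≤ r * ‖v‖) (v : D) :
    ‖v - β (a * b * a⁻¹) v‖ ≤ r * ‖v‖ := by
  have := hb (β a⁻¹ v)
  rw [hβ, ← hβ a, map_sub] at this
  simp only [← mul_apply_eq_comp, ← map_mul] at this
  simp only [mul_inv_cancel, ← mul_assoc, map_one, one_apply_eq_self] at this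
  rwa [norm_sub_rev]

include hβ in
lemma norm_commutator_sub (a b : Q) {r s : ℝ} (hr : 0 ≤ r) (ha : ∀ v, ‖β a v - v‖ ≤ r * ‖v‖)
    (hb : ∀ v, ‖β b v - v‖ ≤ s * ‖v‖) (v : D) :
    ‖β ⁅a, b⁆ v - v‖ ≤ 2 * r * s * ‖v‖ := by
  obtain ⟨w, rfl⟩ : ∃ w, v = β (b * a) w :=
    ⟨β (b * a)⁻¹ v, by rw [← mul_apply_eq_comp, ← map_mul]; simp⟩
  have h1 : β ⁅a, b⁆ (β (b * a) w) = β a (β b w) := by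
    rw [← mul_apply_eq_comp, ← map_mul, ← mul_apply_eq_comp, ← map_mul]
    congr 2; simp only [commutatorElement_def]; group
  rw [h1, hβ, map_mul, mul_apply_eq_comp]
  have e : β a (β b w) - β b (β a w)
      = (β a (β b w - w) - (β b w - w)) - (β b (β a w - w) - (β a w - w)) := by
    simp only [map_sub]; abel
  have h2 := ha (β b w - w)
  have h3 := hb (β a w - w)
  have h4 := ha w
  have h5 := hb w
  have h6 := norm_sub_le (β a (β b w - w) - (β b w - w)) (β b (β a w - w) - (β a w - w))
  rw [e]
  by_cases hw : ‖w‖ = 0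
  · have hw' := norm_eq_zero.1 hw
    subst hw'
    simp
  have hwpos : 0 < ‖w‖ := lt_of_le_of_ne (norm_nonneg _) (Ne.symm hw)
  have hs : 0 ≤ s := by
    by_contra hs
    nlinarith [norm_nonneg (β b w - w)]
  nlinarith [mul_le_mul_of_nonneg_left h4 hs, mul_le_mul_of_nonneg_left h5 hr]

include hβ hσ in
lemma iteratedCommutator_bound {a b : Q} (ha : ∀ v, ‖β a v - v‖ ≤ 1 / 4 * ‖v‖)
    (hb : ∀ v, ‖β b v - v‖ ≤ 1 / 4 * ‖v‖) (k : ℕ) :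
    (∀ v, ‖β (iteratedCommutator a b k) v - v‖ ≤ 1 / 4 * (1 / 2) ^ k * ‖v‖) ∧
      ‖σ (iteratedCommutator a b k)‖ ≤ (‖σ b‖ + ‖σ a‖) * (1 / 2) ^ k := by
  induction k with
  | zero => simpa [iteratedCommutator] using hb
  | succ k ih =>
    obtain ⟨ih1, ih2⟩ := ih
    simp only [iteratedCommutator]
    set c := iteratedCommutator a b k
    refine ⟨fun v => ?_, ?_⟩
    · refine (norm_commutator_sub β hβ a c (by norm_num) ha ih1 v).trans (le_of_eq ?_)
      ring
    · rw [cocycle_commutator β σ hσ]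
      have h1 := norm_conj_sub β hβ a c ih1 (σ a)
      have h2 : ‖β a (σ c) - β ⁅a, c⁆ (σ c)‖ ≤ 1 / 4 * ‖σ c‖ := by
        have ha' : ∀ v, ‖β a⁻¹ v - v‖ ≤ 1 / 4 * ‖v‖ := fun v => by
          have := ha (β a⁻¹ v)
          rw [hβ, ← mul_apply_eq_comp, ← map_mul] at this
          simpa [norm_sub_rev] using this
        have h3 := norm_conj_sub β hβ c a⁻¹ ha' (σ c)
        rw [← hβ a, map_sub, ← mul_apply_eq_comp, ← map_mul] at h3
        simpa only [commutatorElement_def, mul_assoc] using h3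
      refine (norm_add_le _ _).trans ?_
      have hk : (0:ℝ) ≤ (1/2)^k := by positivity
      rw [pow_succ]
      nlinarith [norm_nonneg (σ b), mul_nonneg hk (norm_nonneg (σ a)), mul_nonneg hk (norm_nonneg (σ b))]

include hβ hσ in
lemma exists_iteratedCommutator_trivial (hfin : ∀ R : ℝ, {q | ‖σ q‖ ≤ R}.Finite)
    {a b : Q} (ha : ∀ v, ‖β a v - v‖ ≤ 1 / 4 * ‖v‖) (hb : ∀ v, ‖β b v - v‖ ≤ 1 / 4 * ‖v‖) :
    ∃ k, 1 ≤ k ∧ β (iteratedCommutator a b k) = 1 ∧ σ (iteratedCommutator a b k) = 0 := by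
  have bd := iteratedCommutator_bound β hβ σ hσ ha hb
  have lim : ∀ c : ℝ, Tendsto (fun k : ℕ => c * (1 / 2 : ℝ) ^ k) atTop (𝓝 0) := fun c => by
    simpa using (tendsto_pow_atTop_nhds_zero_of_lt_one (r := (1 / 2 : ℝ))
      (by norm_num) (by norm_num)).const_mul c
  have ev : ∀ q ∈ {q | ‖σ q‖ ≤ ‖σ b‖ + ‖σ a‖}, ∀ᶠ k in atTop,
      iteratedCommutator a b k = q → β q = 1 ∧ σ q = 0 := by
    intro q _
    by_cases h1 : σ q = 0
    · by_cases h2 : β q = 1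
      · exact Eventually.of_forall fun _ _ => ⟨h2, h1⟩
      · obtain ⟨v, hv⟩ : ∃ v, β q v ≠ v := by
          by_contra! h
          exact h2 (ContinuousLinearMap.ext h)
        have hpos : 0 < ‖β q v - v‖ := norm_pos_iff.2 (sub_ne_zero.2 hv)
        filter_upwards [(lim (1 / 4 * ‖v‖)).eventually_lt_const hpos] with k hk hq
        have := (bd k).1 v
        rw [hq] at this
        linarith
    · filter_upwards [(lim (‖σ b‖ + ‖σ a‖)).eventually_lt_const (norm_pos_iff.2 h1)] with k hk hq
      have := (bd k).2
      rw [hq] at this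
      linarith
  obtain ⟨k, hk, hk1⟩ := (((eventually_all_finite (hfin _)).2 ev).and
    (eventually_ge_atTop 1)).exists
  refine ⟨k, hk1, hk _ ?_ rfl⟩
  refine (bd k).2.trans (mul_le_of_le_one_right (by positivity) ?_)
  exact pow_le_one₀ (by norm_num) (by norm_num)

include hβ hσ in
lemma commute_linear_of_near_one (hfin : ∀ R : ℝ, {q | ‖σ q‖ ≤ R}.Finite)
    {a b : Q} (ha : ∀ v, ‖β a v - v‖ ≤ 1 / 4 * ‖v‖) (hb : ∀ v, ‖β b v - v‖ ≤ 1 / 4 * ‖v‖) :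
    Commute (β a) (β b) ∧
      β a (β a (σ b) - σ b - (β b (σ a) - σ a)) = β a (σ b) - σ b - (β b (σ a) - σ a) := by
  have bd := iteratedCommutator_bound β hβ σ hσ ha hb
  obtain ⟨k, hk1, hkβ, hkσ⟩ := exists_iteratedCommutator_trivial β hβ σ hσ hfin ha hb
  have step : ∀ j, Commute (β a) (β (iteratedCommutator a b (j + 1))) →
      Commute (β a) (β (iteratedCommutator a b j)) := fun j hj => by
    refine commute_of_commute_commutator β hβ (fun v => ((bd j).1 v).trans ?_) hj
    refine mul_le_mul_of_nonneg_right ?_ (norm_nonneg v)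
    exact mul_le_of_le_one_right (by norm_num) (pow_le_one₀ (by norm_num) (by norm_num))
  have hcomm : ∀ j, Commute (β a) (β (iteratedCommutator a b (k - j))) := by
    intro j
    induction j with
    | zero => rw [Nat.sub_zero, hkβ]; exact Commute.one_right _
    | succ j ih =>
      rcases Nat.lt_or_ge j k with h | h
      · have e : k - j = (k - (j + 1)) + 1 := by omega
        rw [e] at ih
        exact step _ ih
      · have e : k - (j + 1) = k - j := by omega
        rwa [e]
  have h0 : Commute (β a) (β b) := by simpa [iteratedCommutator] using hcomm k
  have hinv : ∀ x : Q, β x * β x⁻¹ = 1 := fun x => by rw [← map_mul]; simp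
  have triv : ∀ c : Q, Commute (β a) (β c) → β ⁅a, c⁆ = 1 := fun c hc => by
    rw [commutatorElement_def]
    simp only [map_mul]
    rw [hc.eq, mul_assoc (β c), hinv, mul_one, hinv]
  have trans : ∀ c : Q, Commute (β a) (β c) →
      σ ⁅a, c⁆ = β a (σ c) - σ c - (β c (σ a) - σ a) := fun c hc => by
    rw [cocycle_commutator β σ hσ, triv c hc]
    have : β (a * c * a⁻¹) = β c := by
      simp only [map_mul]; rw [hc.eq, mul_assoc, hinv, mul_one]
    rw [this, one_apply_eq_self]; abel
  have hone : ∀ j, β (iteratedCommutator a b (j + 1)) = 1 := by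
    intro j
    induction j with
    | zero => exact triv _ h0
    | succ j ih => exact triv _ (by rw [ih]; exact Commute.one_right _)
  have hfix : ∀ j, β a (σ (iteratedCommutator a b (k - j - 1 + 1))) =
      σ (iteratedCommutator a b (k - j - 1 + 1)) := by
    intro j
    induction j with
    | zero =>
      have e : k - 0 - 1 + 1 = k := by omega
      rw [e, hkσ, map_zero]
    | succ j ih =>
      rcases Nat.lt_or_ge (j + 1) k with h | h
      · have e : k - j - 1 + 1 = (k - (j + 1) - 1 + 1) + 1 := by omega
        set i := k - (j + 1) - 1 with hi
        rw [e] at ih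
        have t := trans (iteratedCommutator a b (i + 1)) (by rw [hone i]; exact Commute.one_right _)
        rw [hone i, one_apply_eq_self, sub_self, sub_zero] at t
        change σ (iteratedCommutator a b (i + 1 + 1)) = _ at t
        rw [t] at ih
        exact isometry_fixed_of_fixed_sub (hβ a) ih
      · have e : k - (j + 1) - 1 + 1 = k - j - 1 + 1 := by omega
        rwa [e]
  refine ⟨h0, ?_⟩
  have := hfix (k - 1)
  have e : k - (k - 1) - 1 + 1 = 1 := by omega
  rw [e] at this
  rw [← trans b h0]
  exact this

/-- If `A` is a linear isometry, a fixed vector of `A` is orthogonal to every `Av - v`. -/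
lemma inner_sub_eq_zero_of_fixed {A : D →L[ℝ] D} (hA : ∀ v, ‖A v‖ = ‖v‖) {t : D} (ht : A t = t)
    (v : D) : inner ℝ t (A v - v) = 0 := by
  have : inner ℝ (A t) (A v) = inner ℝ t v :=
    (LinearIsometry.mk A.toLinearMap hA).inner_map_map t v
  rw [ht] at this
  rw [inner_sub_right, this, sub_self]

include hβ hσ in
lemma commute_of_near_one (hfin : ∀ R : ℝ, {q | ‖σ q‖ ≤ R}.Finite)
    {a b : Q} (ha : ∀ v, ‖β a v - v‖ ≤ 1 / 4 * ‖v‖) (hb : ∀ v, ‖β b v - v‖ ≤ 1 / 4 * ‖v‖) :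
    β (a * b) = β (b * a) ∧ σ (a * b) = σ (b * a) := by
  obtain ⟨h1, h2⟩ := commute_linear_of_near_one β hβ σ hσ hfin ha hb
  obtain ⟨-, h3⟩ := commute_linear_of_near_one β hβ σ hσ hfin hb ha
  set t := β a (σ b) - σ b - (β b (σ a) - σ a) with ht
  have h3' : β b t = t := by
    have : β b (σ a) - σ a - (β a (σ b) - σ b) = -t := by rw [ht]; abel
    rw [this, map_neg, neg_inj] at h3
    exact h3
  have h4 : inner ℝ t t = 0 := by
    nth_rewrite 2 [ht]
    rw [inner_sub_right, inner_sub_eq_zero_of_fixed (hβ a) h2,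
      inner_sub_eq_zero_of_fixed (hβ b) h3', sub_zero]
  have h5 : t = 0 := inner_self_eq_zero.1 h4
  refine ⟨by rw [map_mul, map_mul]; exact h1.eq, ?_⟩
  rw [hσ, hσ, ← sub_eq_zero, ← h5, ht]; abel

end Group

section NearOne

variable {Q : Type*} [Group Q] {D : Type*} [NormedAddCommGroup D] [InnerProductSpace ℝ D]
  (β : Q →* (D →L[ℝ] D)) (hβ : ∀ q v, ‖β q v‖ = ‖v‖)

/-- The subgroup generated by the elements whose linear part is close to the identity. -/
def nearOneSubgroup : Subgroup Q :=
  Subgroup.closure {q | ∀ v, ‖β q v - v‖ ≤ 1 / 4 * ‖v‖}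

include hβ in
lemma nearOneSubgroup_finiteIndex [FiniteDimensional ℝ D] : (nearOneSubgroup β).FiniteIndex := by
  have : ProperSpace (D →L[ℝ] D) := FiniteDimensional.proper ℝ _
  have hball : ∀ q, β q ∈ Metric.closedBall (0 : D →L[ℝ] D) 1 := fun q => by
    rw [mem_closedBall_zero_iff]
    exact ContinuousLinearMap.opNorm_le_bound _ zero_le_one fun v => by rw [hβ, one_mul]
  obtain ⟨t, ht, hcov⟩ := Metric.totallyBounded_iff.1
    (isCompact_closedBall (0 : D →L[ℝ] D) 1).totallyBounded (1 / 8) (by norm_num)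
  have hex : ∀ q, ∃ c : t, ‖β q - c‖ < 1 / 8 := fun q => by
    obtain ⟨c, hc, h⟩ := Set.mem_iUnion₂.1 (hcov (hball q))
    exact ⟨⟨c, hc⟩, by rwa [← dist_eq_norm]⟩
  choose c hc using hex
  have := ht.to_subtype
  have key : ∀ p q, c p = c q → (p : Q ⧸ nearOneSubgroup β) = q := by
    intro p q hpq
    rw [QuotientGroup.eq]
    refine Subgroup.subset_closure fun v => ?_
    have h1 : ‖β q - β p‖ ≤ 1 / 4 := by
      have h2 := hc p
      have h3 := hc q
      rw [hpq] at h2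
      have := norm_sub_le (β q - c q) (β p - c q)
      rw [sub_sub_sub_cancel_right] at this
      linarith
    have h4 := (β q - β p).le_opNorm v
    have h5 : β p (β (p⁻¹ * q) v - v) = (β q - β p) v := by
      rw [map_sub, ← mul_apply_eq_comp, ← map_mul]; simp
    rw [← h5, hβ] at h4
    exact h4.trans (mul_le_mul_of_nonneg_right h1 (norm_nonneg v))
  have : Finite (Q ⧸ nearOneSubgroup β) := by
    refine Finite.of_injective (fun x : Q ⧸ nearOneSubgroup β => c x.out) fun x y h => ?_
    rw [← QuotientGroup.out_eq' x, ← QuotientGroup.out_eq' y]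
    exact key _ _ h
  exact Subgroup.finiteIndex_of_finite_quotient

variable (σ : Q → D) (hσ : ∀ p q, σ (p * q) = σ p + β p (σ q))

include hβ hσ in
lemma nearOneSubgroup_commute (hfin : ∀ R : ℝ, {q | ‖σ q‖ ≤ R}.Finite)
    {a b : Q} (ha : a ∈ nearOneSubgroup β) (hb : b ∈ nearOneSubgroup β) :
    β (a * b) = β (b * a) ∧ σ (a * b) = σ (b * a) := by
  let φ : Q →* Function.End D :=
    { toFun := fun q x => β q x + σ q
      map_one' := by
        funext x
        change β 1 x + σ 1 = x
        simp [cocycle_one β σ hσ]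
      map_mul' := fun p q => by
        funext x
        change β (p * q) x + σ (p * q) = β p (β q x + σ q) + σ p
        simp only [map_mul, mul_apply_eq_comp, hσ, map_add]
        abel }
  have hφ : ∀ p q, φ p = φ q ↔ β p = β q ∧ σ p = σ q := by
    refine fun p q => ⟨fun h => ?_, fun h => ?_⟩
    · have h' : ∀ x, β p x + σ p = β q x + σ q := fun x => congrFun h x
      have h0 : σ p = σ q := by simpa using h' 0
      refine ⟨?_, h0⟩
      ext x
      simpa [h0] using h' x
    · funext x
      change β p x + σ p = β q x + σ q
      rw [h.1, h.2]
  have hcomm : Commute (φ a) (φ b) := by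
    have h1 : ∀ x ∈ {q | ∀ v, ‖β q v - v‖ ≤ 1 / 4 * ‖v‖}, Commute (φ x) (φ b) := by
      intro x hx
      unfold nearOneSubgroup at hb
      induction hb using Subgroup.closure_induction with
      | mem y hy =>
        rw [commute_iff_eq, ← map_mul, ← map_mul, hφ]
        exact commute_of_near_one β hβ σ hσ hfin hx hy
      | one => rw [map_one]; exact Commute.one_right _
      | mul y z _ _ hy hz => rw [map_mul]; exact hy.mul_right hz
      | inv y _ hy =>
        have e : φ y * φ y⁻¹ = 1 := by rw [← map_mul]; simp
        have e' : φ y⁻¹ * φ y = 1 := by rw [← map_mul]; simp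
        exact (Commute.units_inv_right (u := ⟨φ y, φ y⁻¹, e, e'⟩) hy)
    unfold nearOneSubgroup at ha
    induction ha using Subgroup.closure_induction with
    | mem y hy => exact h1 y hy
    | one => rw [map_one]; exact Commute.one_left _
    | mul y z _ _ hy hz => rw [map_mul]; exact hy.mul_left hz
    | inv y _ hy =>
      have e : φ y * φ y⁻¹ = 1 := by rw [← map_mul]; simp
      have e' : φ y⁻¹ * φ y = 1 := by rw [← map_mul]; simp
      exact (Commute.units_inv_left (u := ⟨φ y, φ y⁻¹, e, e'⟩) hy)
  rw [← hφ, map_mul, map_mul]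
  exact hcomm

end NearOne

section CommonPoint

variable {Q : Type*} [Group Q] {D : Type*} [NormedAddCommGroup D] [InnerProductSpace ℝ D]
  [FiniteDimensional ℝ D]
  (β : Q →* (D →L[ℝ] D)) (hβ : ∀ q v, ‖β q v‖ = ‖v‖)
  (σ : Q → D) (hσ : ∀ p q, σ (p * q) = σ p + β p (σ q))

include hβ hσ in
/-- A commuting group of isometries has a point all of whose displacement vectors are fixed by the
linear parts. -/
lemma exists_displacement_fixed (hcomm : ∀ a b, β (a * b) = β (b * a) ∧ σ (a * b) = σ (b * a)) :
    ∃ x : D, ∀ p q, β p (β q x + σ q - x) = β q x + σ q - x := by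
  have hβc : ∀ p q v, β p (β q v) = β q (β p v) := fun p q v => by
    rw [← mul_apply_eq_comp, ← map_mul, (hcomm p q).1, map_mul, mul_apply_eq_comp]
  have hd : ∀ p q x, β p (β q x + σ q - x) - (β q x + σ q - x)
      = β q (β p x + σ p - x) - (β p x + σ p - x) := fun p q x => by
    have := (hcomm p q).2
    rw [hσ, hσ] at this
    simp only [map_sub, map_add, hβc p q]
    have e : β p (σ q) = σ q + β q (σ p) - σ p := by rw [← this]; abel
    rw [e]; abel
  let S : Set (Submodule ℝ D) := {W | (∀ q, ∀ w ∈ W, β q w ∈ W) ∧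
    ∃ x, ∀ q, β q x + σ q - x ∈ W}
  obtain ⟨W, ⟨hW, x, hx⟩, hmin⟩ := (wellFounded_lt (α := Submodule ℝ D)).has_min S
    ⟨⊤, fun _ _ _ => Submodule.mem_top, 0, fun _ => Submodule.mem_top⟩
  have hfix : ∀ q, ∀ w ∈ W, β q w = w := by
    intro q
    let g : W →ₗ[ℝ] W := ((β q).toLinearMap.restrict (hW q)) - LinearMap.id
    have hg : ∀ w : W, ((g w : W) : D) = β q w - w := fun w => rfl
    obtain ⟨w, hw⟩ : ∃ w : W, g (g w) = g ⟨_, hx q⟩ := by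
      let g' : LinearMap.range g →ₗ[ℝ] LinearMap.range g :=
        g.restrict (fun y _ => LinearMap.mem_range_self g y)
      have hinj : Function.Injective g' := by
        rw [← LinearMap.ker_eq_bot, LinearMap.ker_eq_bot']
        rintro ⟨-, u, rfl⟩ h
        have h1 : g (g u) = 0 := congrArg Subtype.val h
        have h2 := congrArg Subtype.val h1
        rw [hg, hg, ZeroMemClass.coe_zero, sub_eq_zero] at h2
        have h3 := isometry_fixed_of_fixed_sub (hβ q) h2
        ext
        change ((g u : W) : D) = 0
        rw [hg, h3, sub_self]
      obtain ⟨⟨-, w, rfl⟩, hy⟩ := (LinearMap.injective_iff_surjective.1 hinj)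
        ⟨g ⟨_, hx q⟩, LinearMap.mem_range_self g _⟩
      exact ⟨w, congrArg Subtype.val hy⟩
    let W' : Submodule ℝ D := W ⊓ LinearMap.ker ((β q).toLinearMap - LinearMap.id)
    have memW' : ∀ v, v ∈ W' ↔ v ∈ W ∧ β q v = v := fun v => by
      simp [W', sub_eq_zero]
    have hdisp : ∀ r, β r (x - w) + σ r - (x - w) = (β r x + σ r - x) - (β r w - w) := fun r => by
      rw [map_sub]; abel
    have hW'S : W' ∈ S := by
      refine ⟨fun r v hv => ?_, x - w, fun r => ?_⟩
      · rw [memW'] at hv ⊢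
        exact ⟨hW r v hv.1, by rw [hβc, hv.2]⟩
      · rw [memW']
        constructor
        · rw [hdisp]
          exact W.sub_mem (hx r) (W.sub_mem (hW r w w.2) w.2)
        · have hq : β q (β q (x - w) + σ q - (x - w)) = β q (x - w) + σ q - (x - w) := by
            have h2 := congrArg Subtype.val hw
            rw [hg, hg, hg] at h2
            rw [hdisp, ← sub_eq_zero, map_sub, sub_sub_sub_comm, ← h2, sub_self]
          refine isometry_fixed_of_fixed_sub (hβ q) ?_
          rw [hd q r, map_sub, hβc, hq]
    have hWW : W = W' := by
      by_contra hne
      exact hmin W' hW'S (lt_of_le_of_ne inf_le_left (Ne.symm hne))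
    intro v hv
    rw [hWW, memW'] at hv
    exact hv.2
  exact ⟨x, fun p q => hfix p _ (hx q)⟩

end CommonPoint

section Lattice

variable {D : Type*} [NormedAddCommGroup D] [InnerProductSpace ℝ D] [FiniteDimensional ℝ D]

omit [InnerProductSpace ℝ D] [FiniteDimensional ℝ D] in
lemma discreteTopology_of_finite_inter_closedBall (L : AddSubgroup D)
    (hL : ∀ R : ℝ, {x : D | x ∈ L ∧ ‖x‖ ≤ R}.Finite) : DiscreteTopology L := by
  refine discreteTopology_of_isOpen_singleton_zero ?_
  have hfin : ({x : L | ‖(x : D)‖ ≤ 1} \ {0}).Finite := by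
    refine Set.Finite.subset ((hL 1).preimage Subtype.val_injective.injOn) ?_
    rintro x ⟨hx, -⟩
    exact ⟨x.2, hx⟩
  have he : ({0} : Set L) = Metric.ball 0 1 ∩ ({x : L | ‖(x : D)‖ ≤ 1} \ {0})ᶜ := by
    ext x
    simp only [Set.mem_singleton_iff, Set.mem_inter_iff, mem_ball_zero_iff, Set.mem_compl_iff,
      Set.mem_sdiff, Set.mem_ofPred_eq, not_and, not_not]
    refine ⟨?_, fun h => h.2 (le_of_lt h.1)⟩
    rintro rfl
    simp
  rw [he]
  exact Metric.isOpen_ball.inter hfin.isClosed.isOpen_compl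

/-- A group embedding into Euclidean space with finitely many elements in each ball is free abelian
of rank at most the dimension. -/
lemma exists_mulEquiv_of_discrete_embedding {A : Type*} [Group A] (τ : A →* Multiplicative D)
    (hinj : Function.Injective τ)
    (hfin : ∀ R : ℝ, {a | ‖(τ a).toAdd‖ ≤ R}.Finite) :
    ∃ m ≤ Module.finrank ℝ D, Nonempty (A ≃* Multiplicative (Fin m → ℤ)) := by
  let L : AddSubgroup D := AddMonoidHom.range (MonoidHom.toAdditiveLeft τ)
  have hdisc : DiscreteTopology L := discreteTopology_of_finite_inter_closedBall L fun R => by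
    refine ((hfin R).image fun a => (τ a).toAdd).subset ?_
    rintro x ⟨⟨a, rfl⟩, hx⟩
    exact ⟨a.toMul, hx, rfl⟩
  let L' : Submodule ℤ D := AddSubgroup.toIntSubmodule L
  have : DiscreteTopology L' := hdisc
  have hr : Module.finrank ℤ L' ≤ Module.finrank ℝ D := by
    have hs : DiscreteTopology (Submodule.span ℤ (L' : Set D)) := by
      rw [Submodule.span_eq]; infer_instance
    have := Real.finrank_eq_int_finrank_of_discrete hs
    unfold Set.finrank at this
    rw [Submodule.span_eq] at this
    rw [← this]
    exact Submodule.finrank_le _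
  refine ⟨_, hr, ⟨?_⟩⟩
  let e1 : L' ≃+ (Fin (Module.finrank ℤ L') → ℤ) :=
    (Module.finBasis ℤ L').equivFun.toAddEquiv
  let e2 : Additive A ≃+ L := AddEquiv.ofBijective (MonoidHom.toAdditiveLeft τ).rangeRestrict
    ⟨fun x y h => hinj (congrArg Subtype.val h), AddMonoidHom.rangeRestrict_surjective _⟩
  exact AddEquiv.toMultiplicativeRight (e2.trans e1)

end Lattice

section Bieberbach

/-- A group with finite kernel over a finitely generated abelian group has a finite index subgroup
meeting the kernel trivially. -/
lemma exists_finiteIndex_inf_ker_eq_bot {U M : Type*} [Group U] [CommGroup M] (τ : U →* M)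
    [IsMulTorsionFree M] [Finite τ.ker] [Group.FG τ.range] :
    ∃ B : Subgroup U, B.FiniteIndex ∧ ∀ b ∈ B, τ b = 1 → b = 1 := by
  have hfg : Group.FG U := by
    obtain ⟨S, hS, hSfin⟩ := Group.fg_iff.1 ‹Group.FG τ.range›
    let s : τ.range → U := fun y => y.2.choose
    have hs : ∀ y, τ (s y) = y := fun y => y.2.choose_spec
    refine Group.fg_iff.2 ⟨(τ.ker : Set U) ∪ s '' S, ?_,
      (Set.toFinite (τ.ker : Set U)).union (hSfin.image s)⟩
    set C := Subgroup.closure ((τ.ker : Set U) ∪ s '' S)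
    have h1 : ∀ y : τ.range, ∃ c ∈ C, τ c = y := by
      intro y
      have hy : y ∈ Subgroup.closure S := hS ▸ Subgroup.mem_top y
      induction hy using Subgroup.closure_induction with
      | mem y hy => exact ⟨s y, Subgroup.subset_closure (Or.inr ⟨y, hy, rfl⟩), hs y⟩
      | one => exact ⟨1, C.one_mem, by simp⟩
      | mul x y _ _ hx hy =>
        obtain ⟨c, hc, hcx⟩ := hx
        obtain ⟨d, hd, hdy⟩ := hy
        exact ⟨c * d, C.mul_mem hc hd, by simp [hcx, hdy]⟩
      | inv x _ hx =>
        obtain ⟨c, hc, hcx⟩ := hx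
        exact ⟨c⁻¹, C.inv_mem hc, by simp [hcx]⟩
    refine eq_top_iff.2 fun u _ => ?_
    obtain ⟨c, hc, hcu⟩ := h1 ⟨τ u, u, rfl⟩
    have : u * c⁻¹ ∈ C := Subgroup.subset_closure (Or.inl (by
      change τ (u * c⁻¹) = 1
      rw [map_mul, map_inv, hcu, mul_inv_cancel]))
    simpa using C.mul_mem this hc
  have hcomm : Finite (commutatorSet U) := by
    refine ((Set.toFinite (τ.ker : Set U)).subset ?_).to_subtype
    rintro _ ⟨a, b, rfl⟩
    change τ ⁅a, b⁆ = 1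
    rw [map_commutatorElement, commutatorElement_eq_one_iff_commute]
    exact Commute.all _ _
  let N := Nat.card τ.ker
  have hN : N ≠ 0 := Nat.card_pos.ne'
  let _ : CommGroup (Subgroup.center U) :=
    { (inferInstance : Group (Subgroup.center U)) with
      mul_comm := fun a b => Subtype.ext (Subgroup.mem_center_iff.1 b.2 a) }
  let P : Subgroup (Subgroup.center U) := (powMonoidHom (α := Subgroup.center U) N).range
  have hP : P.FiniteIndex := Subgroup.finiteIndex_range_powMonoidHom_of_fg _ hN
  refine ⟨P.map (Subgroup.center U).subtype, ⟨?_⟩, ?_⟩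
  · rw [Subgroup.index_map_subtype]
    exact mul_ne_zero hP.index_ne_zero (Subgroup.finiteIndex_center (G := U)).index_ne_zero
  · rintro _ ⟨_, ⟨z, rfl⟩, rfl⟩ h
    have h1 : τ z ^ N = 1 := by simpa using h
    have h2 : (z : U) ∈ τ.ker := (pow_eq_one_iff_left hN).1 h1
    have h3 : (⟨z, h2⟩ : τ.ker) ^ N = 1 := pow_card_eq_one'
    simpa using congrArg Subtype.val h3

variable {Q : Type*} [Group Q] {D : Type*} [NormedAddCommGroup D] [InnerProductSpace ℝ D]
  [FiniteDimensional ℝ D]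
  (β : Q →* (D →L[ℝ] D)) (hβ : ∀ q v, ‖β q v‖ = ‖v‖)
  (σ : Q → D) (hσ : ∀ p q, σ (p * q) = σ p + β p (σ q))

include hβ hσ in
/-- **Bieberbach's theorem**: a group acting properly discontinuously on a Euclidean space has a
normal finite index subgroup which is free abelian of rank at most the dimension. -/
theorem exists_normal_finiteIndex_free_abelian (hfin : ∀ R : ℝ, {q | ‖σ q‖ ≤ R}.Finite) :
    ∃ A : Subgroup Q, A.Normal ∧ A.FiniteIndex ∧
      ∃ m ≤ Module.finrank ℝ D, Nonempty (A ≃* Multiplicative (Fin m → ℤ)) := by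
  let U := nearOneSubgroup β
  have hU : U.FiniteIndex := nearOneSubgroup_finiteIndex β hβ
  obtain ⟨x, hx⟩ := exists_displacement_fixed (β.comp U.subtype) (fun q => hβ q)
    (fun q : U => σ q) (fun p q => hσ p q)
    (fun a b => nearOneSubgroup_commute β hβ σ hσ hfin a.2 b.2)
  let τ : U →* Multiplicative D :=
    { toFun := fun q => Multiplicative.ofAdd (β q x + σ q - x)
      map_one' := by simp [cocycle_one β σ hσ]
      map_mul' := fun p q => by
        rw [← ofAdd_add]
        congr 1
        have := hx p q
        simp only [MonoidHom.comp_apply, Subgroup.subtype_apply, map_sub, map_add] at this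
        simp only [Subgroup.coe_mul, map_mul, mul_apply_eq_comp, hσ]
        rw [add_sub_assoc, ← this]
        abel }
  have hτ : ∀ q : U, (τ q).toAdd = β q x + σ q - x := fun q => rfl
  have hτfin : ∀ R : ℝ, {q | ‖(τ q).toAdd‖ ≤ R}.Finite := fun R => by
    refine Set.Finite.subset ((hfin (R + 2 * ‖x‖)).preimage Subtype.val_injective.injOn) ?_
    intro q hq
    have h1 : σ q = (τ q).toAdd - β q x + x := by rw [hτ]; abel
    have h2 := norm_add_le ((τ q).toAdd - β q x) x
    have h3 := norm_sub_le (τ q).toAdd (β q x)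
    rw [hβ] at h3
    change ‖σ q‖ ≤ _
    have hq' : ‖(τ q).toAdd‖ ≤ R := hq
    rw [h1]; linarith
  have hker : Finite τ.ker := by
    refine ((hτfin 0).subset fun q hq => ?_).to_subtype
    have : τ q = 1 := hq
    simp [this]
  have hrange : Group.FG τ.range := by
    obtain ⟨m, -, ⟨e⟩⟩ := exists_mulEquiv_of_discrete_embedding τ.range.subtype
      Subtype.val_injective fun R => by
        refine ((hτfin R).image τ.rangeRestrict).subset ?_
        rintro ⟨_, q, rfl⟩ hq
        exact ⟨q, hq, rfl⟩
    exact Group.fg_of_surjective (f := e.symm.toMonoidHom) e.symm.surjective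
  have : IsAddTorsionFree D := .of_isTorsionFree ℝ D
  obtain ⟨B, hB, hBτ⟩ := exists_finiteIndex_inf_ker_eq_bot τ
  have hB' : (B.map U.subtype).FiniteIndex := ⟨by
    rw [Subgroup.index_map_subtype]
    exact mul_ne_zero hB.index_ne_zero hU.index_ne_zero⟩
  refine ⟨(B.map U.subtype).normalCore, inferInstance, inferInstance, ?_⟩
  have hle : (B.map U.subtype).normalCore ≤ U :=
    (Subgroup.normalCore_le _).trans (Subgroup.map_subtype_le B)
  refine exists_mulEquiv_of_discrete_embedding (τ.comp (Subgroup.inclusion hle)) ?_ fun R => ?_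
  · rw [injective_iff_map_eq_one]
    rintro ⟨a, ha⟩ h
    obtain ⟨b, hb, rfl⟩ := Subgroup.normalCore_le _ ha
    have := hBτ b hb h
    ext
    simp [this]
  · exact (hτfin R).preimage (Subgroup.inclusion_injective hle).injOn

end Bieberbach

section ClosedSubgroup

open NormedSpace

variable {𝔸 : Type*} [NormedRing 𝔸] [NormedAlgebra ℝ 𝔸]

omit [NormedAlgebra ℝ 𝔸] in
lemma norm_pow_sub_pow_le [NormOneClass 𝔸] {a b : 𝔸} {M : ℝ} (hM : 1 ≤ M) (ha : ‖a‖ ≤ M)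
    (hb : ‖b‖ ≤ M) (m : ℕ) : ‖a ^ m - b ^ m‖ ≤ m * M ^ m * ‖a - b‖ := by
  have hM0 : 0 ≤ M := zero_le_one.trans hM
  induction m with
  | zero => simp
  | succ m ih =>
    have e : a ^ (m + 1) - b ^ (m + 1) = a ^ m * (a - b) + (a ^ m - b ^ m) * b := by
      rw [pow_succ, pow_succ]; noncomm_ring
    have h1 : ‖a ^ m * (a - b)‖ ≤ M ^ (m + 1) * ‖a - b‖ := by
      refine (norm_mul_le _ _).trans (mul_le_mul_of_nonneg_right ?_ (norm_nonneg _))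
      refine (norm_pow_le _ _).trans ((pow_le_pow_left₀ (norm_nonneg _) ha m).trans ?_)
      exact pow_le_pow_right₀ hM (Nat.le_succ m)
    have h2 : ‖(a ^ m - b ^ m) * b‖ ≤ m * M ^ m * ‖a - b‖ * M :=
      (norm_mul_le _ _).trans (mul_le_mul ih hb (norm_nonneg _) (by positivity))
    rw [e]
    refine (norm_add_le _ _).trans ((add_le_add h1 h2).trans (le_of_eq ?_))
    push_cast
    ring

variable [FiniteDimensional ℝ 𝔸]

lemma continuous_exp_of_finiteDimensional : Continuous (exp : 𝔸 → 𝔸) := by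
  have := FiniteDimensional.complete ℝ 𝔸
  let _ := NormedAlgebra.restrictScalars ℚ ℝ 𝔸
  exact exp_continuous

lemma exp_add_smul (s t : ℝ) (X : 𝔸) : exp ((s + t) • X) = exp (s • X) * exp (t • X) := by
  have := FiniteDimensional.complete ℝ 𝔸
  let _ := NormedAlgebra.restrictScalars ℚ ℝ 𝔸
  rw [add_smul]
  exact exp_add_of_commute (((Commute.refl X).smul_left s).smul_right t)

lemma exp_smul_mul_exp_neg_smul (t : ℝ) (X : 𝔸) : exp (t • X) * exp ((-t) • X) = 1 := by
  rw [← exp_add_smul, add_neg_cancel, zero_smul, exp_zero]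

lemma exp_natCast_mul_smul (m : ℕ) (t : ℝ) (X : 𝔸) :
    exp ((m * t) • X) = exp (t • X) ^ m := by
  have := FiniteDimensional.complete ℝ 𝔸
  let _ := NormedAlgebra.restrictScalars ℚ ℝ 𝔸
  rw [mul_smul, Nat.cast_smul_eq_nsmul, exp_nsmul]

lemma hasDerivAt_exp_smul_zero (X : 𝔸) : HasDerivAt (fun t : ℝ => exp (t • X)) X 0 := by
  have := FiniteDimensional.complete ℝ 𝔸
  simpa using hasDerivAt_exp_smul_const (𝕂 := ℝ) X (0 : ℝ)

variable {S : Submonoid 𝔸} (hS : IsClosed (S : Set 𝔸))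

include hS in
lemma exp_smul_mem_of_tendsto [NormOneClass 𝔸] {ι : Type*} {l : Filter ι} [l.NeBot] {g : ι → 𝔸}
    {t : ι → ℝ} (hg : ∀ᶠ i in l, g i ∈ S) (ht : Tendsto t l (𝓝 0)) (hpos : ∀ᶠ i in l, 0 < t i)
    {X : 𝔸} (hX : Tendsto (fun i => (t i)⁻¹ • (g i - 1)) l (𝓝 X)) {s : ℝ} (hs : 0 ≤ s) :
    exp (s • X) ∈ S := by
  let m : ι → ℕ := fun i => ⌊s / t i⌋₊
  have hm : Tendsto (fun i => m i * t i) l (𝓝 s) := by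
    refine tendsto_of_tendsto_of_tendsto_of_le_of_le' (g := fun i => s - t i) (h := fun _ => s)
      (by simpa using tendsto_const_nhds.sub ht) tendsto_const_nhds ?_ ?_
    · filter_upwards [hpos] with i hi
      have h1 := Nat.lt_floor_add_one (s / t i)
      rw [div_lt_iff₀ hi] at h1
      change s - t i ≤ (⌊s / t i⌋₊ : ℝ) * t i
      linarith
    · filter_upwards [hpos] with i hi
      exact (le_div_iff₀ hi).1 (Nat.floor_le (div_nonneg hs hi.le))
  have hE : Tendsto (fun i => (t i)⁻¹ • (exp (t i • X) - 1)) l (𝓝 X) := by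
    have h1 := hasDerivAt_iff_tendsto_slope_zero.1 (hasDerivAt_exp_smul_zero X)
    have h2 : Tendsto t l (𝓝[≠] 0) :=
      tendsto_nhdsWithin_iff.2 ⟨ht, hpos.mono fun i hi => ne_of_gt hi⟩
    refine (h1.comp h2).congr fun i => ?_
    simp
  set c := ‖X‖ + 1
  have hbound : ∀ {a : ι → 𝔸}, Tendsto (fun i => (t i)⁻¹ • (a i - 1)) l (𝓝 X) →
      ∀ᶠ i in l, ‖a i‖ ≤ Real.exp (t i * c) := by
    intro a ha
    filter_upwards [hpos, (ha.norm).eventually_lt_const (lt_add_one ‖X‖)] with i hi hlt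
    rw [norm_smul, norm_inv, Real.norm_of_nonneg hi.le, inv_mul_lt_iff₀ hi] at hlt
    have h1 := norm_add_le (a i - 1) 1
    rw [sub_add_cancel, norm_one] at h1
    have h2 := Real.add_one_le_exp (t i * c)
    linarith
  have hdiff : Tendsto (fun i => g i ^ m i - exp (t i • X) ^ m i) l (𝓝 0) := by
    have h0 : Tendsto (fun i => (m i * t i) * Real.exp ((m i * t i) * c) *
        ‖(t i)⁻¹ • (g i - 1) - (t i)⁻¹ • (exp (t i • X) - 1)‖) l (𝓝 0) := by
      have h1 := (hm.mul (Real.continuous_exp.continuousAt.tendsto.comp (hm.mul_const c))).mul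
        (hX.sub hE).norm
      simpa using h1
    refine squeeze_zero_norm' ?_ h0
    filter_upwards [hpos, hbound hX, hbound hE] with i hi hgi hei
    refine (norm_pow_sub_pow_le (Real.one_le_exp (by positivity)) hgi hei (m i)).trans
      (le_of_eq ?_)
    rw [← smul_sub, sub_sub_sub_cancel_right, norm_smul, norm_inv, Real.norm_of_nonneg hi.le,
      ← Real.exp_nat_mul]
    field_simp
  have hexp : Tendsto (fun i => exp (t i • X) ^ m i) l (𝓝 (exp (s • X))) := by
    have h1 := continuous_exp_of_finiteDimensional.continuousAt.tendsto.comp (hm.smul_const X)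
    exact h1.congr fun i => exp_natCast_mul_smul _ _ _
  have := hdiff.add hexp
  simp only [sub_add_cancel, zero_add] at this
  exact hS.mem_of_tendsto this (hg.mono fun i hi => S.pow_mem hi _)

variable (hinv : ∀ a ∈ S, ∀ b, a * b = 1 → b ∈ S)

include hS hinv in
lemma forall_exp_smul_mem_of_tendsto [NormOneClass 𝔸] {ι : Type*} {l : Filter ι} [l.NeBot]
    {g : ι → 𝔸} {t : ι → ℝ} (hg : ∀ᶠ i in l, g i ∈ S) (ht : Tendsto t l (𝓝 0))
    (hpos : ∀ᶠ i in l, 0 < t i) {X : 𝔸} (hX : Tendsto (fun i => (t i)⁻¹ • (g i - 1)) l (𝓝 X))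
    (s : ℝ) : exp (s • X) ∈ S := by
  rcases le_total 0 s with hs | hs
  · exact exp_smul_mem_of_tendsto hS hg ht hpos hX hs
  · refine hinv _ (exp_smul_mem_of_tendsto hS hg ht hpos hX (neg_nonneg.2 hs)) _ ?_
    simpa using exp_smul_mul_exp_neg_smul (-s) X

/-- The Lie algebra of a closed group `S` inside a finite-dimensional algebra. -/
def lieSubmodule [NormOneClass 𝔸] (hS : IsClosed (S : Set 𝔸))
    (hinv : ∀ a ∈ S, ∀ b, a * b = 1 → b ∈ S) : Submodule ℝ 𝔸 where
  carrier := {X | ∀ t : ℝ, exp (t • X) ∈ S}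
  zero_mem' := fun t => by simp
  smul_mem' := fun c X hX t => by rw [smul_smul]; exact hX _
  add_mem' := by
    intro X Y hX hY
    have h0 : HasDerivAt (fun t : ℝ => exp (t • X) * exp (t • Y)) (X + Y) 0 := by
      have h := (hasDerivAt_exp_smul_zero X).mul (hasDerivAt_exp_smul_zero Y)
      simp only [zero_smul, exp_zero, one_mul, mul_one] at h
      exact h
    have h1 := hasDerivAt_iff_tendsto_slope_zero.1 h0
    refine forall_exp_smul_mem_of_tendsto hS hinv (l := 𝓝[>] (0 : ℝ)) (t := id)
      (g := fun t => exp (t • X) * exp (t • Y)) ?_ (tendsto_id'.2 nhdsWithin_le_nhds)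
      self_mem_nhdsWithin ?_
    · exact .of_forall fun t => S.mul_mem (hX t) (hY t)
    · have h2 := h1.mono_left (nhdsWithin_mono (0 : ℝ) (fun x (hx : 0 < x) => ne_of_gt hx))
      exact h2.congr fun t => by simp

variable [NormOneClass 𝔸]

lemma eventually_eq_zero_of_exp_mem {C : Submodule ℝ 𝔸} (hC : Disjoint (lieSubmodule hS hinv) C) :
    ∀ᶠ B : C in 𝓝 0, exp (B : 𝔸) ∈ S → B = 0 := by
  have := FiniteDimensional.complete ℝ 𝔸
  by_contra hcon
  rw [not_eventually] at hcon
  simp only [Classical.not_imp] at hcon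
  let l : Filter C := 𝓝 0 ⊓ 𝓟 {B : C | exp (B : 𝔸) ∈ S ∧ B ≠ 0}
  have hl : l.NeBot := frequently_mem_iff_neBot.1 hcon
  let U : Ultrafilter C := Ultrafilter.of l
  have hU : (U : Filter C) ≤ l := Ultrafilter.of_le l
  have hU0 : Tendsto (fun B : C => B) U (𝓝 0) := hU.trans inf_le_left
  have hUm : ∀ᶠ B : C in U, exp (B : 𝔸) ∈ S ∧ B ≠ 0 := le_principal_iff.1 (hU.trans inf_le_right)
  have hcpt : IsCompact (Metric.sphere (0 : C) 1) := isCompact_sphere 0 1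
  obtain ⟨X, hX1, hX⟩ := hcpt.ultrafilter_le_nhds (U.map fun B => ‖B‖⁻¹ • B) (by
    rw [le_principal_iff]
    change ∀ᶠ B : C in U, ‖B‖⁻¹ • B ∈ Metric.sphere (0 : C) 1
    filter_upwards [hUm] with B hB
    rw [mem_sphere_zero_iff_norm, norm_smul, norm_inv, norm_norm,
      inv_mul_cancel₀ (norm_ne_zero_iff.2 hB.2)])
  have hX' : Tendsto (fun B : C => ‖B‖⁻¹ • (B : 𝔸)) U (𝓝 X) :=
    (continuous_subtype_val.tendsto X).comp hX
  have hU0' : Tendsto (fun B : C => (B : 𝔸)) U (𝓝 0) :=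
    (continuous_subtype_val.tendsto (0 : C)).comp hU0
  have hexp : Tendsto (fun B : C => ‖B‖⁻¹ • (exp (B : 𝔸) - 1)) U (𝓝 X) := by
    have h1 := hasFDerivAt_iff_tendsto.1 (hasFDerivAt_exp_zero (𝕂 := ℝ) (𝔸 := 𝔸))
    have h2 : Tendsto (fun B : C => ‖B‖⁻¹ • (exp (B : 𝔸) - 1 - B)) U (𝓝 0) := by
      rw [tendsto_zero_iff_norm_tendsto_zero]
      refine (h1.comp hU0').congr fun B => ?_
      simp [norm_smul]
    have h3 := h2.add hX'
    simpa [← smul_add] using h3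
  have hXmem : (X : 𝔸) ∈ lieSubmodule hS hinv := by
    refine forall_exp_smul_mem_of_tendsto hS hinv (hUm.mono fun B hB => hB.1) ?_ ?_ hexp
    · exact norm_zero (E := C) ▸ hU0.norm
    · exact hUm.mono fun B hB => norm_pos_iff.2 hB.2
  have h0 : (X : 𝔸) = 0 := Submodule.disjoint_def.1 hC _ hXmem X.2
  have : X = 0 := Subtype.ext h0
  rw [this] at hX1
  simp at hX1

/-- Near the identity, a closed group is the exponential image of its Lie algebra. -/
theorem eventually_exists_exp_eq :
    ∀ᶠ a in 𝓝 (1 : 𝔸), a ∈ S → ∃ X ∈ lieSubmodule hS hinv, exp X = a := by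
  have := FiniteDimensional.complete ℝ 𝔸
  let 𝔥 := lieSubmodule hS hinv
  obtain ⟨C, hC⟩ := 𝔥.exists_isCompl
  let F : 𝔥 × C → 𝔸 := fun p => exp (p.1 : 𝔸) * exp (p.2 : 𝔸)
  let L1 : 𝔥 × C →L[ℝ] 𝔸 := 𝔥.subtypeL.comp (ContinuousLinearMap.fst ℝ 𝔥 C)
  let L2 : 𝔥 × C →L[ℝ] 𝔸 := C.subtypeL.comp (ContinuousLinearMap.snd ℝ 𝔥 C)
  have hF : HasStrictFDerivAt F (L1 + L2) 0 := by
    have h1 : HasStrictFDerivAt (fun p : 𝔥 × C => exp (p.1 : 𝔸)) L1 0 := by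
      have h := HasStrictFDerivAt.comp (0 : 𝔥 × C) (g := exp) (f := L1)
        (g' := (1 : 𝔸 →L[ℝ] 𝔸)) (by rw [map_zero]; exact hasStrictFDerivAt_exp_zero)
        L1.hasStrictFDerivAt
      exact h
    have h2 : HasStrictFDerivAt (fun p : 𝔥 × C => exp (p.2 : 𝔸)) L2 0 := by
      have h := HasStrictFDerivAt.comp (0 : 𝔥 × C) (g := exp) (f := L2)
        (g' := (1 : 𝔸 →L[ℝ] 𝔸)) (by rw [map_zero]; exact hasStrictFDerivAt_exp_zero)
        L2.hasStrictFDerivAt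
      exact h
    have h3 := h1.mul' h2
    have hL : exp (((0 : 𝔥 × C).1 : 𝔥) : 𝔸) • L2 +
        MulOpposite.op (exp (((0 : 𝔥 × C).2 : C) : 𝔸)) • L1 = L1 + L2 := by
      simp [add_comm]
    rw [hL] at h3
    exact h3
  have hrange : (L1 + L2).range = ⊤ := by
    rw [eq_top_iff]
    intro a _
    obtain ⟨u, hu, v, hv, rfl⟩ := Submodule.mem_sup.1 (hC.sup_eq_top ▸ Submodule.mem_top (x := a))
    exact ⟨(⟨u, hu⟩, ⟨v, hv⟩), rfl⟩
  have hmap := hF.map_nhds_eq_of_surj hrange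
  have hF0 : F 0 = 1 := by simp [F]
  rw [hF0] at hmap
  rw [← hmap, eventually_map]
  have hev := eventually_eq_zero_of_exp_mem hS hinv hC.disjoint
  have hev' : ∀ᶠ p : 𝔥 × C in 𝓝 0, exp (p.2 : 𝔸) ∈ S → p.2 = 0 :=
    (continuous_snd.tendsto (0 : 𝔥 × C)).eventually hev
  filter_upwards [hev'] with p hp hpS
  have h1 : exp (p.2 : 𝔸) ∈ S := by
    have h2 : exp (-(p.1 : 𝔸)) * F p = exp (p.2 : 𝔸) := by
      have := exp_smul_mul_exp_neg_smul (-1) (p.1 : 𝔸)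
      simp only [neg_smul, one_smul, neg_neg] at this
      simp only [F]
      rw [← mul_assoc, this, one_mul]
    rw [← h2]
    refine S.mul_mem ?_ hpS
    simpa using p.1.2 (-1)
  refine ⟨p.1, p.1.2, ?_⟩
  simp [F, hp h1]

end ClosedSubgroup

section AffineRep

variable {V : Type*} [NormedAddCommGroup V] [InnerProductSpace ℝ V]

/-- The linear part of an isometry. -/
noncomputable def linPart : (V ≃ᵢ V) →* (V →L[ℝ] V) where
  toFun h := (h.toRealLinearIsometryEquiv : V →L[ℝ] V)
  map_one' := by
    ext x
    simp
  map_mul' g h := by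
    ext x
    have hg : ∀ a b : V, g (a + b) = g a + g b - g 0 := fun a b => by
      have := map_add g.toRealLinearIsometryEquiv a b
      simp only [IsometryEquiv.toRealLinearIsometryEquiv_apply] at this
      rw [sub_eq_iff_eq_add] at this
      rw [this]; abel
    have h1 := hg (h x - h 0) (h 0)
    simp only [sub_add_cancel] at h1
    simp only [ContinuousLinearEquiv.coe_coe, LinearIsometryEquiv.coe_coe,
      IsometryEquiv.toRealLinearIsometryEquiv_apply,
      IsometryEquiv.mul_apply, mul_apply_eq_comp, h1]
    abel

lemma linPart_apply (h : V ≃ᵢ V) (x : V) : linPart h x = h x - h 0 :=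
  h.toRealLinearIsometryEquiv_apply x

lemma apply_eq_linPart_add (h : V ≃ᵢ V) (x : V) : h x = linPart h x + h 0 := by
  rw [linPart_apply, sub_add_cancel]

lemma apply_add_eq (h : V ≃ᵢ V) (x u : V) : h (x + u) = h x + linPart h u := by
  rw [apply_eq_linPart_add h (x + u), apply_eq_linPart_add h x, map_add]; abel

lemma linPart_sub (h : V ≃ᵢ V) (x y : V) : linPart h (x - y) = h x - h y := by
  rw [map_sub, linPart_apply, linPart_apply]; abel

lemma norm_linPart (h : V ≃ᵢ V) (x : V) : ‖linPart h x‖ = ‖x‖ :=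
  h.toRealLinearIsometryEquiv.norm_map x

lemma linPart_inv_apply (h : V ≃ᵢ V) (x : V) : linPart h⁻¹ (linPart h x) = x := by
  rw [← mul_apply_eq_comp, ← map_mul]; simp

lemma linPart_apply_inv (h : V ≃ᵢ V) (x : V) : linPart h (linPart h⁻¹ x) = x := by
  rw [← mul_apply_eq_comp, ← map_mul]; simp

/-- The representation of the isometry group by affine matrices. -/
noncomputable def affineRep : (V ≃ᵢ V) →* ((V × ℝ) →L[ℝ] (V × ℝ)) where
  toFun h := ((linPart h).comp (ContinuousLinearMap.fst ℝ V ℝ) +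
    (ContinuousLinearMap.snd ℝ V ℝ).smulRight (h 0)).prod (ContinuousLinearMap.snd ℝ V ℝ)
  map_one' := by
    ext x <;> simp
  map_mul' g h := by
    ext x
    · simp
    · simp
    · simp [apply_eq_linPart_add g (h 0)]
    · simp

lemma affineRep_apply (h : V ≃ᵢ V) (w : V × ℝ) :
    affineRep h w = (linPart h w.1 + w.2 • h 0, w.2) := rfl

lemma affineRep_one_right (h : V ≃ᵢ V) (x : V) : affineRep h (x, 1) = (h x, 1) := by
  rw [affineRep_apply, apply_eq_linPart_add h x, one_smul]

lemma affineRep_zero_right (h : V ≃ᵢ V) (x : V) : affineRep h (x, 0) = (linPart h x, 0) := by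
  rw [affineRep_apply]; simp

lemma affineRep_injective : Function.Injective (affineRep : (V ≃ᵢ V) →* _) := by
  intro g h hgh
  ext x
  have := affineRep_one_right h x
  rw [← hgh, affineRep_one_right] at this
  exact congrArg Prod.fst this

lemma affineRep_mul_inv (h : V ≃ᵢ V) : affineRep h * affineRep h⁻¹ = 1 := by
  rw [← map_mul, mul_inv_cancel, map_one]

lemma affineRep_inv_mul (h : V ≃ᵢ V) : affineRep h⁻¹ * affineRep h = 1 := by
  rw [← map_mul, inv_mul_cancel, map_one]

lemma norm_affineRep_le (h : V ≃ᵢ V) : ‖affineRep h‖ ≤ 1 + ‖h 0‖ := by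
  refine ContinuousLinearMap.opNorm_le_bound _ (by positivity) fun w => ?_
  rw [affineRep_apply, Prod.norm_def]
  have h1 : ‖w.1‖ ≤ ‖w‖ := norm_fst_le w
  have h2 : ‖w.2‖ ≤ ‖w‖ := norm_snd_le w
  refine max_le ?_ ?_
  · refine (norm_add_le _ _).trans ?_
    rw [norm_linPart, norm_smul]
    nlinarith [mul_le_mul_of_nonneg_right h2 (norm_nonneg (h 0))]
  · change ‖w.2‖ ≤ _
    nlinarith [mul_nonneg (norm_nonneg (h 0)) (norm_nonneg w)]

end AffineRep

section InvariantSubspace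

variable {V : Type*} [NormedAddCommGroup V] [InnerProductSpace ℝ V] [FiniteDimensional ℝ V]

lemma sum_inner_orthonormalBasis {F ι : Type*} [Fintype ι] [NormedAddCommGroup F]
    [InnerProductSpace ℝ F] [FiniteDimensional ℝ F] (b : OrthonormalBasis ι ℝ F)
    (K L : F →ₗ[ℝ] V) :
    ∑ i, inner ℝ (K (b i)) (L (b i)) = LinearMap.trace ℝ F (K.adjoint ∘ₗ L) := by
  rw [LinearMap.trace_eq_sum_inner _ b]
  exact Finset.sum_congr rfl fun i _ => by
    rw [LinearMap.comp_apply, LinearMap.adjoint_inner_right]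

lemma linPart_starProjection_orthogonal {H : Subgroup (V ≃ᵢ V)} {T : Submodule ℝ V}
    (hT : ∀ h ∈ H, ∀ v ∈ T, linPart h v ∈ T) {h : V ≃ᵢ V} (hh : h ∈ H) (v : V) :
    Tᗮ.starProjection (linPart h v) = linPart h (Tᗮ.starProjection v) := by
  have hin : ∀ x y, inner ℝ (linPart h x) (linPart h y) = inner ℝ x y :=
    fun x y => h.toRealLinearIsometryEquiv.inner_map_map x y
  have key : ∀ w ∈ Tᗮ, linPart h w ∈ Tᗮ := by
    intro w hw
    rw [Submodule.mem_orthogonal] at hw ⊢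
    intro u hu
    rw [← linPart_apply_inv h u, hin]
    exact hw _ (hT _ (inv_mem hh) u hu)
  refine Submodule.eq_starProjection_of_mem_of_inner_eq_zero
    (key _ (Submodule.starProjection_apply_mem _ _)) fun w hw => ?_
  rw [← map_sub, ← linPart_apply_inv h w, hin]
  have hw' : linPart h⁻¹ w ∈ Tᗮ := by
    rw [Submodule.mem_orthogonal] at hw ⊢
    intro u hu
    rw [← hin, linPart_apply_inv]
    exact hw _ (hT _ hh u hu)
  exact Submodule.starProjection_inner_eq_zero v _ hw'

/-- Least squares: an affine map between Euclidean spaces has a point where its norm is minimal,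
and any other point with the same norm has the same value. -/
lemma exists_norm_eq_imp_map_sub_eq_zero {F : Type*} [NormedAddCommGroup F] [InnerProductSpace ℝ F]
    (Λ : V →ₗ[ℝ] F) (b : F) :
    ∃ x, ∀ y, ‖b + Λ y‖ = ‖b + Λ x‖ → Λ (y - x) = 0 := by
  obtain ⟨x, hx⟩ : (LinearMap.range Λ).starProjection (-b) ∈ LinearMap.range Λ :=
    Submodule.starProjection_apply_mem _ _
  refine ⟨x, fun y hy => ?_⟩
  have h1 : inner ℝ (b + Λ x) (Λ (y - x)) = 0 := by
    have := Submodule.starProjection_inner_eq_zero (K := LinearMap.range Λ) (-b) (Λ (y - x))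
      (LinearMap.mem_range_self _ _)
    rw [← hx] at this
    rw [← neg_eq_zero, ← inner_neg_left, ← this]
    congr 1
    abel
  have h2 : b + Λ y = (b + Λ x) + Λ (y - x) := by rw [map_sub]; abel
  have h3 := norm_add_sq_eq_norm_sq_add_norm_sq_real h1
  rw [← h2, hy] at h3
  have h4 : ‖Λ (y - x)‖ * ‖Λ (y - x)‖ = 0 := by linarith
  exact norm_eq_zero.1 (mul_self_eq_zero.1 h4)

end InvariantSubspace

section Geometry

variable {V : Type*} [NormedAddCommGroup V] [InnerProductSpace ℝ V]

/-- The vectors generating the translations in a Lie algebra of affine vector fields. -/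
def translationSpace (𝔥 : Submodule ℝ ((V × ℝ) →L[ℝ] (V × ℝ))) : Submodule ℝ V where
  carrier := {v | ∃ X ∈ 𝔥, ∀ x, X (x, 1) = (v, 0)}
  zero_mem' := ⟨0, 𝔥.zero_mem, fun _ => rfl⟩
  add_mem' := by
    rintro v w ⟨X, hX, hv⟩ ⟨Y, hY, hw⟩
    exact ⟨X + Y, 𝔥.add_mem hX hY, fun x => by simp [hv, hw]⟩
  smul_mem' := by
    rintro c v ⟨X, hX, hv⟩
    exact ⟨c • X, 𝔥.smul_mem c hX, fun x => by simp [hv]⟩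

/-- The linear part of an affine vector field. -/
noncomputable def fieldLinPart : ((V × ℝ) →L[ℝ] (V × ℝ)) →ₗ[ℝ] (V →ₗ[ℝ] V) where
  toFun X := LinearMap.fst ℝ V ℝ ∘ₗ X.toLinearMap ∘ₗ LinearMap.inl ℝ V ℝ
  map_add' X Y := by ext; simp
  map_smul' c X := by ext; simp

lemma fieldLinPart_apply (X : (V × ℝ) →L[ℝ] (V × ℝ)) (u : V) :
    fieldLinPart X u = (X (u, 0)).1 := rfl

lemma field_add (X : (V × ℝ) →L[ℝ] (V × ℝ)) (x u : V) :
    (X (x + u, 1)).1 = (X (x, 1)).1 + fieldLinPart X u := by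
  rw [fieldLinPart_apply, ← Prod.fst_add, ← map_add]; simp

variable {H : Subgroup (V ≃ᵢ V)} {𝔥 : Submodule ℝ ((V × ℝ) →L[ℝ] (V × ℝ))}
  (h𝔥 : ∀ X ∈ 𝔥, ∀ w, (X w).2 = 0)
  (hAd : ∀ h ∈ H, ∀ X ∈ 𝔥, affineRep h * X * affineRep h⁻¹ ∈ 𝔥)

lemma conj_apply_one {X : (V × ℝ) →L[ℝ] (V × ℝ)} (hX : ∀ w, (X w).2 = 0) (h : V ≃ᵢ V) (x : V) :
    ((affineRep h * X * affineRep h⁻¹) (h x, 1)).1 = linPart h (X (x, 1)).1 := by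
  have h1 : affineRep h⁻¹ (h x, 1) = (x, 1) := by
    rw [affineRep_one_right]; simp
  rw [mul_apply_eq_comp, mul_apply_eq_comp, h1, affineRep_apply, hX]
  simp

lemma conj_apply_zero {X : (V × ℝ) →L[ℝ] (V × ℝ)} (hX : ∀ w, (X w).2 = 0) (h : V ≃ᵢ V) (u : V) :
    fieldLinPart (affineRep h * X * affineRep h⁻¹) (linPart h u) =
      linPart h (fieldLinPart X u) := by
  have h1 : affineRep h⁻¹ (linPart h u, 0) = (u, 0) := by
    rw [affineRep_zero_right, linPart_inv_apply]
  rw [fieldLinPart_apply, mul_apply_eq_comp, mul_apply_eq_comp, h1, affineRep_apply, hX,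
    fieldLinPart_apply]
  simp

include h𝔥 in
lemma field_mem_translationSpace {X : (V × ℝ) →L[ℝ] (V × ℝ)} (hX : X ∈ 𝔥)
    (h0 : fieldLinPart X = 0) (x : V) : (X (x, 1)).1 ∈ translationSpace 𝔥 := by
  refine ⟨X, hX, fun y => Prod.ext ?_ (h𝔥 X hX _)⟩
  have := field_add X x (y - x)
  rw [add_sub_cancel, h0] at this
  simpa using this

include h𝔥 hAd in
lemma linPart_mem_translationSpace {h : V ≃ᵢ V} (hh : h ∈ H) {v : V}
    (hv : v ∈ translationSpace 𝔥) : linPart h v ∈ translationSpace 𝔥 := by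
  obtain ⟨X, hX, hXv⟩ := hv
  refine ⟨_, hAd h hh X hX, fun x => Prod.ext ?_ (h𝔥 _ (hAd h hh X hX) _)⟩
  have := conj_apply_one (h𝔥 X hX) h (h⁻¹ x)
  rw [hXv] at this
  simpa using this

end Geometry

section LeastSquares

variable {V : Type*} [NormedAddCommGroup V] [InnerProductSpace ℝ V] [FiniteDimensional ℝ V]

lemma exists_rangeRestrict_comp_eq_id {E F : Type*} [AddCommGroup E] [Module ℝ E]
    [AddCommGroup F] [Module ℝ F] (j : E →ₗ[ℝ] F) :
    ∃ s : LinearMap.range j →ₗ[ℝ] E, j.rangeRestrict ∘ₗ s = LinearMap.id :=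
  LinearMap.exists_rightInverse_of_surjective j.rangeRestrict
    (LinearMap.range_eq_top.2 j.surjective_rangeRestrict)

variable {H : Subgroup (V ≃ᵢ V)} {T : Submodule ℝ V}
  {E : Type*} [AddCommGroup E] [Module ℝ E] {c : E →ₗ[ℝ] V} {K : E →ₗ[ℝ] V →ₗ[ℝ] V}

lemma exists_map_displacement_mem_of_embedding {ι F : Type*} [Fintype ι] [NormedAddCommGroup F]
    [InnerProductSpace ℝ F] [FiniteDimensional ℝ F] (e : OrthonormalBasis ι ℝ V)
    (hs : (V →ₗ[ℝ] V) →ₗ[ℝ] F) (hs_inj : Function.Injective hs)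
    (hs_inner : ∀ K L, inner ℝ (hs K) (hs L) = ∑ i, inner ℝ (K (e i)) (L (e i)))
    (hT : ∀ h ∈ H, ∀ v ∈ T, linPart h v ∈ T) (hcT : ∀ X, K X = 0 → c X ∈ T)
    (hAd : ∀ h ∈ H, ∀ X, ∃ Y, (∀ u, K Y (linPart h u) = linPart h (K X u)) ∧
      ∀ x, c Y + K Y (h x) = linPart h (c X + K X x)) :
    ∃ x : V, ∀ h ∈ H, ∀ X, K X (h x - x) ∈ T := by
  let j : E →ₗ[ℝ] F := hs ∘ₗ K
  have hj : ∀ X, j X = hs (K X) := fun X => rfl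
  obtain ⟨s, hs'⟩ := exists_rangeRestrict_comp_eq_id j
  have hsec : ∀ X, K (s (j.rangeRestrict X)) = K X := fun X => by
    have h1 : j.rangeRestrict (s (j.rangeRestrict X)) = j.rangeRestrict X :=
      LinearMap.congr_fun hs' _
    exact hs_inj (congrArg Subtype.val h1)
  let b := stdOrthonormalBasis ℝ (LinearMap.range j)
  have hjs : ∀ k, j (s (b k)) = b k := fun k =>
    congrArg Subtype.val (LinearMap.congr_fun hs' (b k))
  let P : V →ₗ[ℝ] V := Tᗮ.starProjection.toLinearMap
  have hP0 : ∀ v, P v = 0 ↔ v ∈ T := fun v => by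
    change Tᗮ.starProjection v = 0 ↔ _
    rw [Submodule.starProjection_apply_eq_zero_iff, Submodule.orthogonal_orthogonal]
  have hPh : ∀ h ∈ H, ∀ v, P (linPart h v) = linPart h (P v) :=
    fun h hh v => linPart_starProjection_orthogonal hT hh v
  let L : V → LinearMap.range j →ₗ[ℝ] V := fun x => P ∘ₗ (c + K.flip x) ∘ₗ s
  have hL : ∀ x X, L x (j.rangeRestrict X) = P (c X + K X x) := fun x X => by
    rw [← sub_eq_zero]
    change P _ - P _ = 0
    rw [← map_sub, hP0]
    have h1 := hcT (s (j.rangeRestrict X) - X) (by rw [map_sub, hsec, sub_self])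
    rw [map_sub] at h1
    simpa [hsec] using h1
  have hLb : ∀ x k, L x (b k) = P (c (s (b k)) + K (s (b k)) x) := fun x k => rfl
  let Λ : V →ₗ[ℝ] PiLp 2 (fun _ : Fin (Module.finrank ℝ (LinearMap.range j)) => V) :=
    { toFun := fun u => WithLp.toLp 2 fun k => P (K (s (b k)) u)
      map_add' := fun u v => by ext k; simp
      map_smul' := fun c u => by ext k; simp }
  let b₀ : PiLp 2 (fun _ : Fin (Module.finrank ℝ (LinearMap.range j)) => V) :=
    WithLp.toLp 2 fun k => L 0 (b k)
  have hnorm : ∀ x, ‖b₀ + Λ x‖ ^ 2 = ∑ k, inner ℝ (L x (b k)) (L x (b k)) := fun x => by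
    rw [PiLp.norm_sq_eq_of_L2]
    refine Finset.sum_congr rfl fun k _ => ?_
    rw [real_inner_self_eq_norm_sq]
    congr 2
    change L 0 (b k) + P _ = L x (b k)
    rw [hLb, hLb, ← map_add, map_zero, add_zero]
  have hinv : ∀ h ∈ H, ∀ x, ‖b₀ + Λ (h x)‖ = ‖b₀ + Λ x‖ := by
    intro h hh x
    rw [← sq_eq_sq₀ (norm_nonneg _) (norm_nonneg _), hnorm, hnorm]
    choose Y hY hY' using fun k => hAd h⁻¹ (inv_mem hh) (s (b k))
    let f : Fin (Module.finrank ℝ (LinearMap.range j)) → LinearMap.range j := fun k =>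
      j.rangeRestrict (Y k)
    have hf : Orthonormal ℝ f := by
      rw [orthonormal_iff_ite]
      intro k l
      rw [← orthonormal_iff_ite.1 b.orthonormal k l]
      have h1 : ∀ k i, K (Y k) (e i) = linPart h⁻¹ (K (s (b k)) (linPart h (e i))) := by
        intro k i
        rw [← hY, linPart_inv_apply]
      have h2 : inner ℝ (f k) (f l) =
          ∑ i, inner ℝ (K (s (b k)) (linPart h (e i))) (K (s (b l)) (linPart h (e i))) := by
        rw [Submodule.coe_inner]
        change inner ℝ (j (Y k)) (j (Y l)) = _
        rw [hj, hj, hs_inner]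
        refine Finset.sum_congr rfl fun i _ => ?_
        rw [h1, h1]
        exact h⁻¹.toRealLinearIsometryEquiv.inner_map_map _ _
      have h3 : inner ℝ (b k) (b l) =
          ∑ i, inner ℝ (K (s (b k)) (e i)) (K (s (b l)) (e i)) := by
        rw [Submodule.coe_inner, ← hjs, ← hjs, hj, hj, hs_inner]
      have h4 := sum_inner_orthonormalBasis (e.map h.toRealLinearIsometryEquiv)
        (K (s (b k))) (K (s (b l)))
      rw [h2, h3, sum_inner_orthonormalBasis e, ← h4]
      exact Finset.sum_congr rfl fun i _ => by rw [OrthonormalBasis.map_apply]; rfl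
    let b' : OrthonormalBasis _ ℝ (LinearMap.range j) := OrthonormalBasis.mk hf (by
      rw [hf.linearIndependent.span_eq_top_of_card_eq_finrank' (by simp)])
    have hLb' : ∀ k, L (h x) (b k) = linPart h (L x (b' k)) := by
      intro k
      have h1 := hY' k (h x)
      have h2 : h⁻¹ (h x) = x := by simp
      rw [h2] at h1
      rw [OrthonormalBasis.coe_mk, hL, hLb, ← hPh h hh, h1, linPart_apply_inv]
    rw [sum_inner_orthonormalBasis b (L x), ← sum_inner_orthonormalBasis b' (L x)]
    refine Finset.sum_congr rfl fun k _ => ?_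
    rw [hLb']
    exact h.toRealLinearIsometryEquiv.inner_map_map _ _
  obtain ⟨x, hx⟩ := exists_norm_eq_imp_map_sub_eq_zero Λ b₀
  refine ⟨x, fun h hh X => ?_⟩
  have h1 := hx (h x) (hinv h hh x)
  have h2 : ∀ k, P (K (s (b k)) (h x - x)) = 0 := fun k =>
    congrFun (congrArg WithLp.ofLp h1) k
  let M : LinearMap.range j →ₗ[ℝ] V := P ∘ₗ K.flip (h x - x) ∘ₗ s
  have h3 : M = 0 := b.toBasis.ext fun k => by
    rw [OrthonormalBasis.coe_toBasis]
    exact h2 k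
  have h5 : P (K (s (j.rangeRestrict X)) (h x - x)) = 0 :=
    LinearMap.congr_fun h3 (j.rangeRestrict X)
  rwa [hsec, hP0] at h5

/-- A group of isometries normalizing a space of affine vector fields `x ↦ c X + K X x` has an
orbit along which the linear parts of the vector fields only move points along `T`, provided
that `T` is invariant and contains the constant vector fields. -/
theorem exists_map_displacement_mem
    (hT : ∀ h ∈ H, ∀ v ∈ T, linPart h v ∈ T) (hcT : ∀ X, K X = 0 → c X ∈ T)
    (hAd : ∀ h ∈ H, ∀ X, ∃ Y, (∀ u, K Y (linPart h u) = linPart h (K X u)) ∧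
      ∀ x, c Y + K Y (h x) = linPart h (c X + K X x)) :
    ∃ x : V, ∀ h ∈ H, ∀ X, K X (h x - x) ∈ T := by
  let e := stdOrthonormalBasis ℝ V
  let hs : (V →ₗ[ℝ] V) →ₗ[ℝ] PiLp 2 (fun _ : Fin (Module.finrank ℝ V) => V) :=
    { toFun := fun K => WithLp.toLp 2 fun i => K (e i)
      map_add' := fun K L => rfl
      map_smul' := fun c K => rfl }
  refine exists_map_displacement_mem_of_embedding e hs (fun K L hKL => ?_)
    (fun K L => PiLp.inner_apply _ _) hT hcT hAd
  refine e.toBasis.ext fun i => ?_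
  rw [OrthonormalBasis.coe_toBasis]
  exact congrFun (congrArg WithLp.ofLp hKL) i

end LeastSquares

section Geometry

variable {V : Type*} [NormedAddCommGroup V] [InnerProductSpace ℝ V] [FiniteDimensional ℝ V]
  {H : Subgroup (V ≃ᵢ V)} {𝔥 : Submodule ℝ ((V × ℝ) →L[ℝ] (V × ℝ))}

/-- A group of isometries normalizing a Lie algebra of affine vector fields has an orbit along
which the linear parts of the vector fields only move points by translations of the algebra. -/
theorem exists_fieldLinPart_displacement_mem (h𝔥 : ∀ X ∈ 𝔥, ∀ w, (X w).2 = 0)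
    (hAd : ∀ h ∈ H, ∀ X ∈ 𝔥, affineRep h * X * affineRep h⁻¹ ∈ 𝔥) :
    ∃ x : V, ∀ h ∈ H, ∀ X ∈ 𝔥, fieldLinPart X (h x - x) ∈ translationSpace 𝔥 := by
  let c : 𝔥 →ₗ[ℝ] V :=
    { toFun := fun X => ((X : (V × ℝ) →L[ℝ] (V × ℝ)) (0, 1)).1
      map_add' := fun X Y => rfl
      map_smul' := fun a X => rfl }
  let K : 𝔥 →ₗ[ℝ] V →ₗ[ℝ] V := fieldLinPart.domRestrict 𝔥
  have hfield : ∀ (X : (V × ℝ) →L[ℝ] (V × ℝ)) x,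
      (X (0, 1)).1 + fieldLinPart X x = (X (x, 1)).1 := fun X x => by
    rw [← field_add, zero_add]
  obtain ⟨x, hx⟩ := exists_map_displacement_mem (E := 𝔥) (H := H) (T := translationSpace 𝔥) (c := c)
    (K := K)
    (fun h hh v hv => linPart_mem_translationSpace h𝔥 hAd hh hv)
    (fun X hX => field_mem_translationSpace h𝔥 X.2 hX 0)
    (fun h hh X => ⟨⟨_, hAd h hh X X.2⟩, fun u => conj_apply_zero (h𝔥 X X.2) h u, fun x =>
      ((hfield _ _).trans (conj_apply_one (h𝔥 X X.2) h x)).trans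
        (congrArg _ (hfield _ _).symm)⟩)
  exact ⟨x, fun h hh X hX => hx h hh ⟨X, hX⟩⟩

end Geometry

section RingExp

variable {𝔸 : Type*} [NormedRing 𝔸]

/-- The exponential of a normed ring, with the algebraic and topological structure both coming
from the norm. -/
noncomputable def ringExp (X : 𝔸) : 𝔸 := NormedSpace.exp X

variable [NormedAlgebra ℝ 𝔸]

lemma ringExp_zero_smul (X : 𝔸) : ringExp ((0 : ℝ) • X) = 1 := by
  let _ := NormedAlgebra.restrictScalars ℚ ℝ 𝔸
  rw [ringExp, zero_smul, NormedSpace.exp_zero]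

lemma ringExp_one_smul (X : 𝔸) : ringExp ((1 : ℝ) • X) = ringExp X := by
  rw [one_smul]

lemma hasDerivAt_ringExp_smul [FiniteDimensional ℝ 𝔸] (X : 𝔸) (t : ℝ) :
    HasDerivAt (fun t : ℝ => ringExp (t • X)) (X * ringExp (t • X)) t := by
  have := FiniteDimensional.complete ℝ 𝔸
  exact hasDerivAt_exp_smul_const' X t (𝕂 := ℝ)

lemma ringExp_smul_conj [FiniteDimensional ℝ 𝔸] {a b : 𝔸} (hab : a * b = 1) (hba : b * a = 1)
    (t : ℝ) (X : 𝔸) : ringExp (t • (a * X * b)) = a * ringExp (t • X) * b := by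
  let _ := NormedAlgebra.restrictScalars ℚ ℝ 𝔸
  have := FiniteDimensional.complete ℝ 𝔸
  rw [← smul_mul_assoc, ← mul_smul_comm]
  exact NormedSpace.exp_units_conj (⟨a, b, hab, hba⟩ : 𝔸ˣ) (t • X)

end RingExp

section Flow

variable {V : Type*} [NormedAddCommGroup V] [InnerProductSpace ℝ V] [FiniteDimensional ℝ V]

lemma sub_mem_of_hasDerivAt_mem {W : Submodule ℝ V} {f f' : ℝ → V}
    (hf : ∀ t, HasDerivAt f (f' t) t) (hW : ∀ t, f' t ∈ W) (s t : ℝ) : f t - f s ∈ W := by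
  have h1 : ∀ t, HasDerivAt (fun t => Wᗮ.starProjection (f t)) 0 t := fun t => by
    have := Wᗮ.starProjection.hasFDerivAt.comp_hasDerivAt t (hf t)
    rwa [(Submodule.starProjection_apply_eq_zero_iff _).2
      (by rw [Submodule.orthogonal_orthogonal]; exact hW t)] at this
  have h2 := is_const_of_deriv_eq_zero (fun t => (h1 t).differentiableAt)
    (fun t => (h1 t).deriv) t s
  rw [← Submodule.orthogonal_orthogonal W, ← Submodule.starProjection_apply_eq_zero_iff, map_sub,
    h2, sub_self]

lemma mem_of_hasDerivAt_of_sub_mem {W : Submodule ℝ V} {f : ℝ → V} {f' : V} {s : ℝ}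
    (hf : HasDerivAt f f' s) (hW : ∀ t, f t - f s ∈ W) : f' ∈ W := by
  rw [← Submodule.orthogonal_orthogonal W, ← Submodule.starProjection_apply_eq_zero_iff]
  have h1 := Wᗮ.starProjection.hasFDerivAt.comp_hasDerivAt s hf
  have h2 : (Wᗮ.starProjection ∘ f) = fun _ => Wᗮ.starProjection (f s) := by
    funext t
    rw [Function.comp_apply, ← sub_eq_zero, ← map_sub,
      Submodule.starProjection_apply_eq_zero_iff, Submodule.orthogonal_orthogonal]
    exact hW t
  rw [h2] at h1
  exact h1.unique (hasDerivAt_const _ _)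

/-- `𝔥` is the Lie algebra of the isometry group `H`. -/
def IsLieAlgebraOf (𝔥 : Submodule ℝ ((V × ℝ) →L[ℝ] (V × ℝ))) (H : Subgroup (V ≃ᵢ V)) : Prop :=
  ∀ X, X ∈ 𝔥 ↔ ∀ t : ℝ, ∃ h ∈ H, affineRep h = ringExp (t • X)

/-- The subgroup of isometries generated by the exponentials of a Lie algebra. -/
def expSubgroup (𝔥 : Submodule ℝ ((V × ℝ) →L[ℝ] (V × ℝ))) : Subgroup (V ≃ᵢ V) :=
  Subgroup.closure {h | ∃ X ∈ 𝔥, affineRep h = ringExp X}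

variable {H : Subgroup (V ≃ᵢ V)} {𝔥 : Submodule ℝ ((V × ℝ) →L[ℝ] (V × ℝ))}

omit [FiniteDimensional ℝ V] in
lemma mem_expSubgroup {X : (V × ℝ) →L[ℝ] (V × ℝ)} (hX : X ∈ 𝔥) {h : V ≃ᵢ V} {t : ℝ}
    (hh : affineRep h = ringExp (t • X)) : h ∈ expSubgroup 𝔥 :=
  Subgroup.subset_closure ⟨t • X, 𝔥.smul_mem t hX, hh⟩

namespace IsLieAlgebraOf

variable (h𝔥 : IsLieAlgebraOf 𝔥 H)
include h𝔥

lemma exists_flow {X : (V × ℝ) →L[ℝ] (V × ℝ)} (hX : X ∈ 𝔥) :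
    ∃ φ : ℝ → (V ≃ᵢ V), (∀ t, φ t ∈ H) ∧ (∀ t, affineRep (φ t) = ringExp (t • X)) ∧
      φ 0 = 1 ∧ ∀ x t, HasDerivAt (fun s => φ s x) (X (φ t x, 1)).1 t := by
  choose φ hφH hφ using (h𝔥 X).1 hX
  refine ⟨φ, hφH, hφ, affineRep_injective ?_, fun x t => ?_⟩
  · rw [hφ, map_one]
    exact ringExp_zero_smul X
  · have h1 := ((ContinuousLinearMap.apply ℝ (V × ℝ) ((x, 1) : V × ℝ)).hasFDerivAt).comp_hasDerivAt
      t (hasDerivAt_ringExp_smul X t)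
    have h2 := ((ContinuousLinearMap.fst ℝ V ℝ).hasFDerivAt).comp_hasDerivAt t h1
    have h3 : ∀ s, ringExp (s • X) (x, 1) = (φ s x, 1) := fun s => by
      rw [← hφ, affineRep_one_right]
    rw [← h3]
    refine HasDerivAt.congr_deriv (h2.congr_of_eventuallyEq (Eventually.of_forall fun s => ?_)) rfl
    exact (congrArg Prod.fst (h3 s)).symm

lemma apply_snd {X : (V × ℝ) →L[ℝ] (V × ℝ)} (hX : X ∈ 𝔥) (w : V × ℝ) : (X w).2 = 0 := by
  have h1 := ((ContinuousLinearMap.apply ℝ (V × ℝ) w).hasFDerivAt).comp_hasDerivAt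
      (0 : ℝ) (hasDerivAt_exp_smul_zero X)
  have h2 := ((ContinuousLinearMap.snd ℝ V ℝ).hasFDerivAt).comp_hasDerivAt (0 : ℝ) h1
  have h3 : HasDerivAt (fun _ : ℝ => w.2) (X w).2 0 := by
    refine h2.congr_of_eventuallyEq (Eventually.of_forall fun t => ?_)
    obtain ⟨h, -, hh⟩ := (h𝔥 X).1 hX t
    change w.2 = (ringExp (t • X) w).2
    rw [← hh, affineRep_apply]
  exact h3.unique (hasDerivAt_const _ _)

lemma conj_mem : ∀ h ∈ H, ∀ X ∈ 𝔥, affineRep h * X * affineRep h⁻¹ ∈ 𝔥 := by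
  intro h hh X hX
  rw [h𝔥]
  intro t
  obtain ⟨g, hg, hgX⟩ := (h𝔥 X).1 hX t
  refine ⟨h * g * h⁻¹, H.mul_mem (H.mul_mem hh hg) (H.inv_mem hh), ?_⟩
  rw [map_mul, map_mul, hgX]
  exact (ringExp_smul_conj (affineRep_mul_inv h) (affineRep_inv_mul h) t X).symm

omit [FiniteDimensional ℝ V] in
lemma expSubgroup_le : expSubgroup 𝔥 ≤ H := by
  rw [expSubgroup, Subgroup.closure_le]
  rintro h ⟨X, hX, hh⟩
  obtain ⟨g, hg, hgX⟩ := (h𝔥 X).1 hX 1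
  rwa [affineRep_injective (hh.trans ((ringExp_one_smul X).symm.trans hgX.symm))]

lemma conj_mem_expSubgroup {h : V ≃ᵢ V} (hh : h ∈ H) {n : V ≃ᵢ V} (hn : n ∈ expSubgroup 𝔥) :
    h * n * h⁻¹ ∈ expSubgroup 𝔥 := by
  refine Subgroup.closure_induction (p := fun n _ => h * n * h⁻¹ ∈ expSubgroup 𝔥) ?_ ?_ ?_ ?_ hn
  · rintro n ⟨X, hX, hnX⟩
    refine mem_expSubgroup (h𝔥.conj_mem h hh X hX) (t := 1) ?_
    rw [map_mul, map_mul, hnX, ← ringExp_one_smul X]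
    exact (ringExp_smul_conj (affineRep_mul_inv h) (affineRep_inv_mul h) 1 X).symm
  · simp
  · intro a b _ _ ha hb
    have := mul_mem ha hb
    rwa [show h * a * h⁻¹ * (h * b * h⁻¹) = h * (a * b) * h⁻¹ by group] at this
  · intro a _ ha
    have := inv_mem ha
    rwa [show (h * a * h⁻¹)⁻¹ = h * a⁻¹ * h⁻¹ by group] at this

end IsLieAlgebraOf

end Flow

section Orbits

variable {V : Type*} [NormedAddCommGroup V] [InnerProductSpace ℝ V]

omit [InnerProductSpace ℝ V] in
lemma isometryEquiv_one_apply (x : V) : (1 : V ≃ᵢ V) x = x := rfl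

/-- The directions along which the vector fields of `𝔥` vary only by translations. -/
def hullDirection (𝔥 : Submodule ℝ ((V × ℝ) →L[ℝ] (V × ℝ))) : Submodule ℝ V where
  carrier := {u | ∀ X ∈ 𝔥, fieldLinPart X u ∈ translationSpace 𝔥}
  zero_mem' := fun X _ => by rw [map_zero]; exact Submodule.zero_mem _
  add_mem' := fun hu hv X hX => by rw [map_add]; exact Submodule.add_mem _ (hu X hX) (hv X hX)
  smul_mem' := fun c _ hu X hX => by rw [map_smul]; exact Submodule.smul_mem _ c (hu X hX)

/-- The tangent space at `x` of the orbit. -/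
def orbitDirection (𝔥 : Submodule ℝ ((V × ℝ) →L[ℝ] (V × ℝ))) (x : V) : Submodule ℝ V where
  carrier := {v | ∃ X ∈ 𝔥, (X (x, 1)).1 = v}
  zero_mem' := ⟨0, 𝔥.zero_mem, rfl⟩
  add_mem' := by
    rintro v w ⟨X, hX, rfl⟩ ⟨Y, hY, rfl⟩
    exact ⟨X + Y, 𝔥.add_mem hX hY, rfl⟩
  smul_mem' := by
    rintro c v ⟨X, hX, rfl⟩
    exact ⟨c • X, 𝔥.smul_mem c hX, rfl⟩

lemma translationSpace_le_orbitDirection (𝔥 : Submodule ℝ ((V × ℝ) →L[ℝ] (V × ℝ))) (x : V) :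
    translationSpace 𝔥 ≤ orbitDirection 𝔥 x := by
  rintro v ⟨X, hX, hv⟩
  exact ⟨X, hX, by rw [hv]⟩

lemma field_sub (X : (V × ℝ) →L[ℝ] (V × ℝ)) (x y : V) :
    (X (y, 1)).1 - (X (x, 1)).1 = fieldLinPart X (y - x) := by
  have := field_add X x (y - x)
  rw [add_sub_cancel] at this
  rw [this, add_sub_cancel_left]

variable [FiniteDimensional ℝ V] {H : Subgroup (V ≃ᵢ V)}
  {𝔥 : Submodule ℝ ((V × ℝ) →L[ℝ] (V × ℝ))}

namespace IsLieAlgebraOf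

variable (h𝔥 : IsLieAlgebraOf 𝔥 H)
include h𝔥

lemma linPart_mem_hullDirection {h : V ≃ᵢ V} (hh : h ∈ H) {u : V} (hu : u ∈ hullDirection 𝔥) :
    linPart h u ∈ hullDirection 𝔥 := by
  intro X hX
  have hY := h𝔥.conj_mem _ (inv_mem hh) X hX
  have h1 := conj_apply_zero (fun w => h𝔥.apply_snd hY w) h u
  have h2 : affineRep h * (affineRep h⁻¹ * X * affineRep h⁻¹⁻¹) * affineRep h⁻¹ = X := by
    rw [inv_inv, mul_assoc (affineRep h⁻¹), ← mul_assoc, ← mul_assoc, affineRep_mul_inv, one_mul,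
      mul_assoc, affineRep_mul_inv, mul_one]
  rw [h2] at h1
  rw [h1]
  exact linPart_mem_translationSpace (fun X hX => h𝔥.apply_snd hX) h𝔥.conj_mem hh (hu _ hY)

variable {x₀ : V} (hx₀ : ∀ h ∈ H, h x₀ - x₀ ∈ hullDirection 𝔥)
include hx₀

lemma apply_sub_mem_hullDirection {h : V ≃ᵢ V} (hh : h ∈ H) {x : V}
    (hx : x - x₀ ∈ hullDirection 𝔥) : h x - x₀ ∈ hullDirection 𝔥 := by
  have h1 := Submodule.add_mem _ (h𝔥.linPart_mem_hullDirection hh hx) (hx₀ h hh)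
  rwa [linPart_sub, sub_add_sub_cancel] at h1

lemma orbitDirection_le_hullDirection : orbitDirection 𝔥 x₀ ≤ hullDirection 𝔥 := by
  rintro v ⟨X, hX, rfl⟩
  obtain ⟨φ, hφH, -, hφ0, hφ⟩ := h𝔥.exists_flow hX
  have h1 := hφ x₀ 0
  rw [hφ0, isometryEquiv_one_apply] at h1
  refine mem_of_hasDerivAt_of_sub_mem h1 fun t => ?_
  rw [hφ0, isometryEquiv_one_apply]
  exact hx₀ _ (hφH t)

omit [FiniteDimensional ℝ V] h𝔥 hx₀ in
lemma field_mem_orbitDirection {x : V} (hx : x - x₀ ∈ hullDirection 𝔥)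
    {X : (V × ℝ) →L[ℝ] (V × ℝ)} (hX : X ∈ 𝔥) : (X (x, 1)).1 ∈ orbitDirection 𝔥 x₀ := by
  rw [← sub_add_cancel (X (x, 1)).1 (X (x₀, 1)).1, field_sub]
  exact Submodule.add_mem _ (translationSpace_le_orbitDirection _ _ (hx X hX)) ⟨X, hX, rfl⟩

lemma linPart_mem_orbitDirection : ∀ h ∈ H, ∀ v ∈ orbitDirection 𝔥 x₀,
    linPart h v ∈ orbitDirection 𝔥 x₀ := by
  rintro h hh v ⟨X, hX, rfl⟩
  rw [← conj_apply_one (fun w => h𝔥.apply_snd hX w)]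
  exact field_mem_orbitDirection (hx₀ h hh) (h𝔥.conj_mem h hh X hX)

lemma apply_sub_mem_orbitDirection {n : V ≃ᵢ V} (hn : n ∈ expSubgroup 𝔥) :
    ∀ x, x - x₀ ∈ hullDirection 𝔥 → n x - x ∈ orbitDirection 𝔥 x₀ := by
  refine Subgroup.closure_induction
    (p := fun n _ => ∀ x, x - x₀ ∈ hullDirection 𝔥 → n x - x ∈ orbitDirection 𝔥 x₀) ?_ ?_ ?_ ?_ hn
  · rintro n ⟨X, hX, hnX⟩ x hx
    obtain ⟨φ, hφH, hφX, hφ0, hφ⟩ := h𝔥.exists_flow hX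
    have h1 : φ 1 = n := affineRep_injective ((hφX 1).trans ((ringExp_one_smul X).trans hnX.symm))
    have h2 := sub_mem_of_hasDerivAt_mem (hφ x) (fun t =>
      field_mem_orbitDirection (h𝔥.apply_sub_mem_hullDirection hx₀ (hφH t) hx) hX) 0 1
    rwa [h1, hφ0, isometryEquiv_one_apply] at h2
  · intro x _
    rw [isometryEquiv_one_apply, sub_self]
    exact Submodule.zero_mem _
  · intro a b _ hb iha ihb x hx
    have h1 := iha (b x) (h𝔥.apply_sub_mem_hullDirection hx₀ (h𝔥.expSubgroup_le hb) hx)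
    have h2 := Submodule.add_mem _ h1 (ihb x hx)
    rwa [sub_add_sub_cancel] at h2
  · intro a ha iha x hx
    have h1 := iha (a⁻¹ x)
      (h𝔥.apply_sub_mem_hullDirection hx₀ (inv_mem (h𝔥.expSubgroup_le ha)) hx)
    rw [IsometryEquiv.apply_inv_self] at h1
    rw [← neg_sub]
    exact Submodule.neg_mem _ h1

lemma exists_apply_eq_add {x v : V} (hx : x - x₀ ∈ hullDirection 𝔥)
    (hv : v ∈ orbitDirection 𝔥 x₀) : ∃ n ∈ expSubgroup 𝔥, n x = x + v := by
  obtain ⟨X, hX, rfl⟩ := hv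
  obtain ⟨φ, hφH, hφX, hφ0, hφ⟩ := h𝔥.exists_flow hX
  have h1 : φ 1 x - (1 : ℝ) • (X (x₀, 1)).1 - (φ 0 x - (0 : ℝ) • (X (x₀, 1)).1) ∈
      translationSpace 𝔥 :=
    sub_mem_of_hasDerivAt_mem (f := fun t => φ t x - t • (X (x₀, 1)).1)
      (fun t => (hφ x t).sub ((hasDerivAt_id t).smul_const (X (x₀, 1)).1)) (fun t => by
        rw [one_smul, field_sub]
        exact h𝔥.apply_sub_mem_hullDirection hx₀ (hφH t) hx X hX) 0 1
  rw [hφ0, isometryEquiv_one_apply, one_smul, zero_smul, sub_zero] at h1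
  obtain ⟨Y, hY, hYv⟩ := Submodule.neg_mem _ h1
  obtain ⟨ψ, hψH, hψY, hψ0, hψ⟩ := h𝔥.exists_flow hY
  have h2 : ∀ y, ψ 1 y - (1 : ℝ) • (Y (x₀, 1)).1 - (ψ 0 y - (0 : ℝ) • (Y (x₀, 1)).1) ∈
      (⊥ : Submodule ℝ V) := fun y =>
    sub_mem_of_hasDerivAt_mem (f := fun t => ψ t y - t • (Y (x₀, 1)).1)
      (fun t => (hψ y t).sub ((hasDerivAt_id t).smul_const (Y (x₀, 1)).1)) (fun t => by
        rw [one_smul, hYv, hYv, sub_self]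
        exact Submodule.zero_mem _) 0 1
  have h3 := h2 (φ 1 x)
  rw [hψ0, isometryEquiv_one_apply, one_smul, zero_smul, sub_zero, hYv, Submodule.mem_bot,
    sub_eq_zero, sub_eq_iff_eq_add] at h3
  refine ⟨ψ 1 * φ 1, mul_mem (mem_expSubgroup hY (hψY 1)) (mem_expSubgroup hX (hφX 1)), ?_⟩
  rw [IsometryEquiv.mul_apply, h3]
  have h4 : ∀ a b : V, a + -(a - b - x) = x + b := fun a b => by abel
  exact h4 _ _

end IsLieAlgebraOf

end Orbits

section Descent

variable {G : Type*} [Group G] {D : Type*} [NormedAddCommGroup D] [InnerProductSpace ℝ D]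
  [FiniteDimensional ℝ D]

/-- Bieberbach's theorem for an affine isometric action which is proper modulo a normal subgroup
acting trivially. -/
theorem exists_normal_finiteIndex_free_abelian_modulo (N : Subgroup G) [N.Normal]
    (β : G →* (D →L[ℝ] D)) (hβ : ∀ g v, ‖β g v‖ = ‖v‖) (σ : G → D)
    (hσ : ∀ g h, σ (g * h) = σ g + β g (σ h)) (hβN : ∀ n ∈ N, β n = 1) (hσN : ∀ n ∈ N, σ n = 0)
    (hfin : ∀ R : ℝ, ∃ F : Set G, F.Finite ∧ ∀ g, ‖σ g‖ ≤ R → ∃ f ∈ F, f⁻¹ * g ∈ N) :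
    ∃ A : Subgroup G, A.Normal ∧ A.FiniteIndex ∧ N ≤ A ∧ ∃ m ≤ Module.finrank ℝ D,
      ∃ ψ : A →* Multiplicative (Fin m → ℤ), Function.Surjective ψ ∧
        ∀ a : A, ψ a = 1 ↔ (a : G) ∈ N := by
  let σ' : G ⧸ N → D := Quotient.lift σ fun a b hab => by
    have h1 := QuotientGroup.leftRel_apply.1 hab
    have h2 := hσ a (a⁻¹ * b)
    rw [hσN _ h1, map_zero, add_zero, mul_inv_cancel_left] at h2
    exact h2.symm
  obtain ⟨A, hA, hAf, m, hm, ⟨e⟩⟩ := exists_normal_finiteIndex_free_abelian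
    (QuotientGroup.lift N β hβN) (fun q v => by
      induction q using QuotientGroup.induction_on with
      | H g => exact hβ g v) σ' (fun p q => by
      induction p using QuotientGroup.induction_on with
      | H g =>
        induction q using QuotientGroup.induction_on with
        | H h => exact hσ g h) (fun R => by
      obtain ⟨F, hF, h⟩ := hfin R
      refine (hF.image (QuotientGroup.mk : G → G ⧸ N)).subset fun q hq => ?_
      induction q using QuotientGroup.induction_on with
      | H g =>
        obtain ⟨f, hf, hfg⟩ := h g hq
        exact ⟨f, hf, QuotientGroup.eq.2 hfg⟩)
  refine ⟨A.comap (QuotientGroup.mk' N), hA.comap _,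
    ⟨(Subgroup.index_comap_of_surjective A (QuotientGroup.mk'_surjective N)).trans_ne
      hAf.index_ne_zero⟩,
    fun n hn => ?_, m, hm,
    e.toMonoidHom.comp ((QuotientGroup.mk' N).subgroupComap A), ?_, fun a => ?_⟩
  · rw [Subgroup.mem_comap, QuotientGroup.mk'_apply, (QuotientGroup.eq_one_iff n).2 hn]
    exact A.one_mem
  · exact e.surjective.comp
      ((QuotientGroup.mk' N).subgroupComap_surjective_of_surjective A
        (QuotientGroup.mk'_surjective N))
  · rw [MonoidHom.comp_apply, MulEquiv.coe_toMonoidHom, map_eq_one_iff e e.injective,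
      ← QuotientGroup.eq_one_iff (N := N), Subtype.ext_iff]
    rfl

end Descent

section Quotient

variable {V : Type*} [NormedAddCommGroup V] [InnerProductSpace ℝ V] [FiniteDimensional ℝ V]
  {H : Subgroup (V ≃ᵢ V)} {𝔥 : Submodule ℝ ((V × ℝ) →L[ℝ] (V × ℝ))}

lemma linPart_mem_orthogonal {T : Submodule ℝ V} (hT : ∀ h ∈ H, ∀ v ∈ T, linPart h v ∈ T)
    {h : V ≃ᵢ V} (hh : h ∈ H) {v : V} (hv : v ∈ Tᗮ) : linPart h v ∈ Tᗮ := by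
  have h1 := linPart_starProjection_orthogonal hT hh v
  rw [Submodule.starProjection_eq_self_iff.2 hv] at h1
  exact Submodule.starProjection_eq_self_iff.1 h1

theorem IsLieAlgebraOf.exists_normal_finiteIndex_free_abelian (h𝔥 : IsLieAlgebraOf 𝔥 H)
    (hfin : ∀ R : ℝ, ∃ F : Set H, F.Finite ∧ ∀ g : H, ‖(g : V ≃ᵢ V) 0‖ ≤ R →
      ∃ f ∈ F, f⁻¹ * g ∈ (expSubgroup 𝔥).subgroupOf H) :
    ∃ A : Subgroup H, A.Normal ∧ A.FiniteIndex ∧ (expSubgroup 𝔥).subgroupOf H ≤ A ∧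
      ∃ m ≤ Module.finrank ℝ V, ∃ ψ : A →* Multiplicative (Fin m → ℤ), Function.Surjective ψ ∧
        ∀ a : A, ψ a = 1 ↔ (a : H) ∈ (expSubgroup 𝔥).subgroupOf H := by
  have hN : ((expSubgroup 𝔥).subgroupOf H).Normal :=
    ⟨fun n hn g => h𝔥.conj_mem_expSubgroup g.2 hn⟩
  obtain ⟨x₀, hx⟩ := exists_fieldLinPart_displacement_mem (fun X hX => h𝔥.apply_snd hX)
    h𝔥.conj_mem
  have hx₀ : ∀ h ∈ H, h x₀ - x₀ ∈ hullDirection 𝔥 := fun h hh X hX => hx h hh X hX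
  have h0 : x₀ - x₀ ∈ hullDirection 𝔥 := by rw [sub_self]; exact Submodule.zero_mem _
  set E := orbitDirection 𝔥 x₀ with hE
  have hEinv : ∀ h ∈ H, ∀ v ∈ E, linPart h v ∈ E := h𝔥.linPart_mem_orbitDirection hx₀
  let D : Submodule ℝ V := hullDirection 𝔥 ⊓ Eᗮ
  have hDinv : ∀ h ∈ H, ∀ v ∈ D, linPart h v ∈ D := fun h hh v hv =>
    ⟨h𝔥.linPart_mem_hullDirection hh hv.1, linPart_mem_orthogonal hEinv hh hv.2⟩
  have hPsub : ∀ v, v - Eᗮ.starProjection v ∈ E := fun v => by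
    have := Submodule.sub_starProjection_mem_orthogonal (K := Eᗮ) v
    rwa [Submodule.orthogonal_orthogonal] at this
  have hPD : ∀ v ∈ hullDirection 𝔥, Eᗮ.starProjection v ∈ D := fun v hv => by
    refine ⟨?_, Submodule.starProjection_apply_mem _ _⟩
    have := Submodule.sub_mem _ hv (h𝔥.orbitDirection_le_hullDirection hx₀ (hPsub v))
    rwa [sub_sub_cancel] at this
  let β : H →* (D →L[ℝ] D) :=
    { toFun := fun h => (linPart (h : V ≃ᵢ V)).restrict (hDinv h h.2)
      map_one' := by
        ext v
        change linPart (1 : V ≃ᵢ V) v = v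
        rw [map_one, one_apply_eq_self]
      map_mul' := fun g h => by
        ext v
        change linPart ((g : V ≃ᵢ V) * (h : V ≃ᵢ V)) v = linPart (g : V ≃ᵢ V) (linPart (h : V ≃ᵢ V) v)
        rw [map_mul, mul_apply_eq_comp] }
  let σ : H → D := fun h => ⟨Eᗮ.starProjection ((h : V ≃ᵢ V) x₀ - x₀), hPD _ (hx₀ h h.2)⟩
  have hP0 : ∀ v, Eᗮ.starProjection v = 0 ↔ v ∈ E := fun v => by
    rw [Submodule.starProjection_apply_eq_zero_iff, Submodule.orthogonal_orthogonal]
  obtain ⟨A, hA, hAf, hNA, m, hm, hψ⟩ := exists_normal_finiteIndex_free_abelian_modulo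
    ((expSubgroup 𝔥).subgroupOf H) β (fun g v => norm_linPart (g : V ≃ᵢ V) v) σ (fun g h => by
      refine Subtype.ext ?_
      change Eᗮ.starProjection ((g : V ≃ᵢ V) ((h : V ≃ᵢ V) x₀) - x₀) =
        Eᗮ.starProjection ((g : V ≃ᵢ V) x₀ - x₀) +
          linPart (g : V ≃ᵢ V) (Eᗮ.starProjection ((h : V ≃ᵢ V) x₀ - x₀))
      rw [← linPart_starProjection_orthogonal hEinv g.2, linPart_sub, ← map_add,
        add_comm, sub_add_sub_cancel]) (fun n hn => by
      ext v
      change linPart (n : V ≃ᵢ V) v = v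
      have h1 := h𝔥.apply_sub_mem_orbitDirection hx₀ hn (x₀ + v) (by
        rw [add_sub_cancel_left]; exact v.2.1)
      have h2 := Submodule.sub_mem _ h1 (h𝔥.apply_sub_mem_orbitDirection hx₀ hn x₀ h0)
      have h3 : linPart (n : V ≃ᵢ V) v - v ∈ E := by
        convert h2 using 1
        rw [apply_add_eq]
        have h5 : ∀ a b c d : V, b - c = a + b - (d + c) - (a - d) := fun a b c d => by abel
        exact h5 _ _ _ _
      have h4 : linPart (n : V ≃ᵢ V) v - v ∈ Eᗮ := (D.sub_mem (hDinv n n.2 v v.2) v.2).2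
      exact sub_eq_zero.1 (Submodule.disjoint_def.1 E.orthogonal_disjoint _ h3 h4))
    (fun n hn => Subtype.ext ((hP0 _).2 (h𝔥.apply_sub_mem_orbitDirection hx₀ hn x₀ h0)))
    (fun R => by
      obtain ⟨F, hF, h⟩ := hfin (R + ‖x₀‖ + ‖x₀‖)
      refine ⟨F, hF, fun g hg => ?_⟩
      obtain ⟨n, hn, hng⟩ := h𝔥.exists_apply_eq_add hx₀ (hx₀ g g.2)
        (E.neg_mem (hPsub ((g : V ≃ᵢ V) x₀ - x₀)))
      have h1 : (n * g : V ≃ᵢ V) x₀ = x₀ + σ g := by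
        rw [IsometryEquiv.mul_apply, hng]
        change _ = x₀ + Eᗮ.starProjection ((g : V ≃ᵢ V) x₀ - x₀)
        have h4 : ∀ a b : V, a + -(a - x₀ - b) = x₀ + b := fun a b => by abel
        exact h4 _ _
      have h2 : ‖(n * g : V ≃ᵢ V) 0‖ ≤ R + ‖x₀‖ + ‖x₀‖ := by
        have h3 : dist ((n * g : V ≃ᵢ V) 0) ((n * g : V ≃ᵢ V) x₀) = dist 0 x₀ :=
          (n * g : V ≃ᵢ V).dist_eq 0 x₀
        rw [dist_zero_left, h1, dist_eq_norm] at h3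
        have h5 := norm_sub_norm_le ((n * g : V ≃ᵢ V) 0) (x₀ + (σ g : V))
        have h6 := norm_add_le x₀ (σ g : V)
        have h7 : ‖(σ g : V)‖ ≤ R := hg
        linarith
      obtain ⟨f, hf, hfg⟩ := h (⟨n, h𝔥.expSubgroup_le hn⟩ * g) h2
      refine ⟨f, hf, ?_⟩
      have h8 := hN.conj_mem _ (inv_mem (show (⟨n, h𝔥.expSubgroup_le hn⟩ : H) ∈
        (expSubgroup 𝔥).subgroupOf H from hn)) f⁻¹
      have h9 := mul_mem h8 hfg
      convert h9 using 1
      group)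
  exact ⟨A, hA, hAf, hNA, m, hm.trans (Submodule.finrank_le D), hψ⟩

end Quotient

section LieAlgebra

lemma exists_lieSubmodule {𝔸 : Type*} [NormedRing 𝔸] [NormedAlgebra ℝ 𝔸] [FiniteDimensional ℝ 𝔸]
    [NormOneClass 𝔸] {S : Submonoid 𝔸} (hS : IsClosed (S : Set 𝔸))
    (hinv : ∀ a ∈ S, ∀ b, a * b = 1 → b ∈ S) :
    ∃ 𝔥 : Submodule ℝ 𝔸, (∀ X, X ∈ 𝔥 ↔ ∀ t : ℝ, ringExp (t • X) ∈ S) ∧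
      ∀ᶠ a in 𝓝 (1 : 𝔸), a ∈ S → ∃ X ∈ 𝔥, ringExp X = a :=
  ⟨lieSubmodule hS hinv, fun _ => Iff.rfl, eventually_exists_exp_eq hS hinv⟩

variable {V : Type*} [NormedAddCommGroup V] [InnerProductSpace ℝ V] [FiniteDimensional ℝ V]
  {H : Subgroup (V ≃ᵢ V)}

lemma exists_isLieAlgebraOf (hS : IsClosed (affineRep '' (H : Set (V ≃ᵢ V)))) :
    ∃ 𝔥 : Submodule ℝ ((V × ℝ) →L[ℝ] (V × ℝ)), IsLieAlgebraOf 𝔥 H ∧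
      ∀ᶠ a in 𝓝 (1 : (V × ℝ) →L[ℝ] (V × ℝ)),
        ∀ h ∈ H, affineRep h = a → h ∈ expSubgroup 𝔥 := by
  let S : Submonoid ((V × ℝ) →L[ℝ] (V × ℝ)) := H.toSubmonoid.map affineRep
  have hinv : ∀ a ∈ S, ∀ b, a * b = 1 → b ∈ S := by
    rintro _ ⟨h, hh, rfl⟩ b hb
    refine ⟨h⁻¹, H.inv_mem hh, ?_⟩
    rw [← mul_one (affineRep h⁻¹), ← hb, ← mul_assoc, affineRep_inv_mul, one_mul]
  obtain ⟨𝔥, h1, h2⟩ := exists_lieSubmodule (𝔸 := (V × ℝ) →L[ℝ] (V × ℝ)) (S := S) hS hinv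
  refine ⟨𝔥, h1, ?_⟩
  filter_upwards [h2] with a ha h hh hha
  obtain ⟨X, hX, hXa⟩ := ha ⟨h, hh, hha⟩
  exact Subgroup.subset_closure ⟨X, hX, hha.trans hXa.symm⟩

variable {𝔥 : Submodule ℝ ((V × ℝ) →L[ℝ] (V × ℝ))}

omit [FiniteDimensional ℝ V] in
lemma eventually_inv_mul_mem_expSubgroup
    (hloc : ∀ᶠ a in 𝓝 (1 : (V × ℝ) →L[ℝ] (V × ℝ)),
      ∀ h ∈ H, affineRep h = a → h ∈ expSubgroup 𝔥) {g : V ≃ᵢ V} (hg : g ∈ H) :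
    ∀ᶠ a in 𝓝 (affineRep g), ∀ h ∈ H, affineRep h = a → g⁻¹ * h ∈ expSubgroup 𝔥 := by
  have h1 : Tendsto (fun a => affineRep g⁻¹ * a) (𝓝 (affineRep g)) (𝓝 1) := by
    rw [← affineRep_inv_mul g]
    exact (ContinuousLinearMap.compL ℝ (V × ℝ) (V × ℝ) (V × ℝ) (affineRep g⁻¹)).continuous.tendsto _
  filter_upwards [h1.eventually hloc] with a ha h hh hha
  exact ha _ (mul_mem (inv_mem hg) hh) (by rw [map_mul, hha])

lemma exists_finite_inv_mul_mem_expSubgroup (hS : IsClosed (affineRep '' (H : Set (V ≃ᵢ V))))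
    (hloc : ∀ᶠ a in 𝓝 (1 : (V × ℝ) →L[ℝ] (V × ℝ)),
      ∀ h ∈ H, affineRep h = a → h ∈ expSubgroup 𝔥) (R : ℝ) :
    ∃ F : Set H, F.Finite ∧ ∀ g : H, ‖(g : V ≃ᵢ V) 0‖ ≤ R →
      ∃ f ∈ F, f⁻¹ * g ∈ (expSubgroup 𝔥).subgroupOf H := by
  have := FiniteDimensional.proper ℝ ((V × ℝ) →L[ℝ] (V × ℝ))
  have hK : IsCompact (Metric.closedBall 0 (1 + R) ∩ affineRep '' (H : Set (V ≃ᵢ V))) :=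
    (isCompact_closedBall _ _).inter_right hS
  obtain ⟨F, hF, h⟩ := hK.induction_on (p := fun s => ∃ F : Set H, F.Finite ∧
      ∀ g : H, affineRep (g : V ≃ᵢ V) ∈ s → ∃ f ∈ F, f⁻¹ * g ∈ (expSubgroup 𝔥).subgroupOf H)
    ⟨∅, Set.finite_empty, fun _ hg => hg.elim⟩
    (fun s t hst ⟨F, hF, h⟩ => ⟨F, hF, fun g hg => h g (hst hg)⟩)
    (fun s t ⟨F, hF, h⟩ ⟨F', hF', h'⟩ => ⟨F ∪ F', hF.union hF', fun g hg => by
      rcases hg with hg | hg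
      · obtain ⟨f, hf, hfg⟩ := h g hg
        exact ⟨f, Or.inl hf, hfg⟩
      · obtain ⟨f, hf, hfg⟩ := h' g hg
        exact ⟨f, Or.inr hf, hfg⟩⟩)
    (by
      rintro _ ⟨-, g, hg, rfl⟩
      exact ⟨_, mem_nhdsWithin_of_mem_nhds (eventually_inv_mul_mem_expSubgroup hloc hg),
        {⟨g, hg⟩}, Set.finite_singleton _, fun k hk => ⟨_, rfl, hk k k.2 rfl⟩⟩)
  refine ⟨F, hF, fun g hg => h g ⟨?_, g, g.2, rfl⟩⟩
  exact (mem_closedBall_zero_iff (E := (V × ℝ) →L[ℝ] (V × ℝ))).2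
    ((norm_affineRep_le (g : V ≃ᵢ V)).trans (by linarith))

end LieAlgebra

section Topology

variable {V : Type*} [NormedAddCommGroup V] [InnerProductSpace ℝ V] [FiniteDimensional ℝ V]
  [TopologicalSpace (V ≃ᵢ V)] (hV : IsInducing (fun h : V ≃ᵢ V => (h : V → V)))
  {H : Subgroup (V ≃ᵢ V)}
include hV

lemma continuous_affineRep : Continuous (affineRep : (V ≃ᵢ V) → (V × ℝ) →L[ℝ] (V × ℝ)) := by
  rw [continuous_clm_apply]
  intro w
  have h1 : ∀ x : V, Continuous fun h : V ≃ᵢ V => h x := fun x =>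
    (continuous_apply x).comp hV.continuous
  simp only [affineRep_apply, linPart_apply]
  exact (((h1 _).sub (h1 _)).add ((h1 _).const_smul _)).prodMk continuous_const

lemma isClosed_image_affineRep (hH : IsClosed (H : Set (V ≃ᵢ V))) :
    IsClosed (affineRep '' (H : Set (V ≃ᵢ V))) := by
  obtain ⟨t, ht, htH⟩ := hV.isClosed_iff.1 hH
  have hev : ∀ w, Continuous fun a : (V × ℝ) →L[ℝ] (V × ℝ) => a w := fun w =>
    (ContinuousLinearMap.apply ℝ (V × ℝ) w).continuous
  have hC : IsClosed {a : (V × ℝ) →L[ℝ] (V × ℝ) | (∀ w, (a w).2 = w.2) ∧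
      (∀ u, ‖(a (u, 0)).1‖ = ‖u‖) ∧ (fun x => (a (x, 1)).1) ∈ t} := by
    refine IsClosed.and ?_ (IsClosed.and ?_ ?_)
    · simp only [Set.ofPred_forall]
      exact isClosed_iInter fun w => isClosed_eq (continuous_snd.comp (hev w)) continuous_const
    · simp only [Set.ofPred_forall]
      exact isClosed_iInter fun u =>
        isClosed_eq (continuous_fst.comp (hev _)).norm continuous_const
    · exact ht.preimage (continuous_pi fun x => continuous_fst.comp (hev _))
  convert hC using 1
  ext a
  constructor
  · rintro ⟨h, hh, rfl⟩
    refine ⟨fun w => rfl, fun u => by rw [affineRep_zero_right, norm_linPart], ?_⟩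
    simp only [affineRep_one_right]
    rw [← htH] at hh
    exact hh
  · rintro ⟨h1, h2, h3⟩
    let l : V →ₗᵢ[ℝ] V := ⟨fieldLinPart a, h2⟩
    let h : V ≃ᵢ V := (l.toLinearIsometryEquiv rfl).toIsometryEquiv.trans
      (IsometryEquiv.addRight (a (0, 1)).1)
    have hh : ∀ x, h x = (a (x, 1)).1 := fun x => by
      have := field_add a 0 x
      rw [zero_add, add_comm] at this
      exact this.symm
    have hha : affineRep h = a := by
      refine ContinuousLinearMap.ext fun w => Prod.ext ?_ (h1 w).symm
      rw [affineRep_apply, linPart_apply, hh, hh, field_sub, sub_zero, fieldLinPart_apply,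
        ← Prod.smul_fst, ← Prod.fst_add, ← map_smul, ← map_add]
      simp
    refine ⟨h, ?_, hha⟩
    rw [← htH]
    change (fun x => h x) ∈ t
    simpa only [hh] using h3

variable {𝔥 : Submodule ℝ ((V × ℝ) →L[ℝ] (V × ℝ))}

theorem connectedComponent_one_eq_expSubgroup (h𝔥 : IsLieAlgebraOf 𝔥 H)
    (hloc : ∀ᶠ a in 𝓝 (1 : (V × ℝ) →L[ℝ] (V × ℝ)),
      ∀ h ∈ H, affineRep h = a → h ∈ expSubgroup 𝔥) :
    connectedComponent (1 : H) = (expSubgroup 𝔥).subgroupOf H := by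
  have hcont : Continuous fun h : H => affineRep (h : V ≃ᵢ V) :=
    (continuous_affineRep hV).comp continuous_subtype_val
  have hnear : ∀ g : H, ∀ᶠ h in 𝓝 g, g⁻¹ * h ∈ (expSubgroup 𝔥).subgroupOf H := fun g => by
    filter_upwards [hcont.continuousAt.eventually
      (eventually_inv_mul_mem_expSubgroup hloc g.2)] with h hh
    exact hh h h.2 rfl
  have hclopen : IsClopen ((expSubgroup 𝔥).subgroupOf H : Set H) := by
    constructor
    · rw [← isOpen_compl_iff, isOpen_iff_mem_nhds]
      intro g hg
      filter_upwards [hnear g] with h hh hhN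
      exact hg ((Subgroup.inv_mem_iff _).1 ((Subgroup.mul_mem_cancel_right _ hhN).1 hh))
    · rw [isOpen_iff_mem_nhds]
      intro g hg
      filter_upwards [hnear g] with h hh
      exact (Subgroup.mul_mem_cancel_left _ (inv_mem hg)).1 hh
  refine Set.Subset.antisymm (hclopen.connectedComponent_subset (one_mem _)) fun n hn => ?_
  have key : ∀ m : H, (m : V ≃ᵢ V) = n → ∀ g : H,
      connectedComponent (g * m) = connectedComponent g := by
    refine Subgroup.closure_induction (p := fun n _ => ∀ m : H, (m : V ≃ᵢ V) = n → ∀ g : H,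
      connectedComponent (g * m) = connectedComponent g) ?_ ?_ ?_ ?_
      (show (n : V ≃ᵢ V) ∈ expSubgroup 𝔥 from hn)
    · rintro _ ⟨X, hX, hnX⟩ m rfl g
      obtain ⟨φ, hφH, hφX, hφ0, hφ⟩ := h𝔥.exists_flow hX
      let γ : ℝ → H := fun t => g * ⟨φ t, hφH t⟩
      have hγ : Continuous γ := by
        refine Continuous.subtype_mk (hV.continuous_iff.2 (continuous_pi fun x => ?_)) _
        exact (g : V ≃ᵢ V).continuous.comp
          (continuous_iff_continuousAt.2 fun t => (hφ x t).continuousAt)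
      have h0 : γ 0 = g := Subtype.ext (by
        change (g : V ≃ᵢ V) * φ 0 = g
        rw [hφ0, mul_one])
      have h1 : γ 1 = g * m := by
        have : φ 1 = m :=
          affineRep_injective ((hφX 1).trans ((ringExp_one_smul X).trans hnX.symm))
        exact Subtype.ext (congrArg ((g : V ≃ᵢ V) * ·) this)
      refine (connectedComponent_eq ?_).symm
      exact (isPreconnected_range hγ).subset_connectedComponent ⟨0, h0⟩ ⟨1, h1⟩
    · intro m hm g
      rw [show m = 1 from Subtype.ext hm, mul_one]
    · intro a b ha hb iha ihb m hm g
      have h1 : m = ⟨a, h𝔥.expSubgroup_le ha⟩ * ⟨b, h𝔥.expSubgroup_le hb⟩ := Subtype.ext hm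
      rw [h1, ← mul_assoc, ihb _ rfl, iha _ rfl]
    · intro a ha iha m hm g
      have h1 := iha m⁻¹ (by rw [Subgroup.coe_inv, hm, inv_inv]) (g * m)
      rw [mul_inv_cancel_right] at h1
      exact h1.symm
  have h1 := key n rfl 1
  rw [one_mul] at h1
  rw [← h1]
  exact mem_connectedComponent

end Topology

/-- Let `H` be a closed subgroup of the Euclidean isometry group `ℝⁿ ⋊ O(n)`.  Then the
group of components `H/H°` is {free abelian of rank `≤ n`}-by-finite: there is a normal
finite-index subgroup `A ≤ H` containing the identity component `H°`, together with a
surjection `ψ : A → ℤᵐ` with `m ≤ n` whose kernel is exactly `H°`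
(so that `A/H° ≅ ℤᵐ` is a finite-index normal subgroup of `H/H°`). -/
theorem components_of_closed_euclidean_isometry_group
    (n : ℕ) (H : Subgroup (EuclideanIsomGroup n)) (hH : IsClosed (H : Set (EuclideanIsomGroup n))) :
    ∃ (A : Subgroup H) (m : ℕ), m ≤ n ∧ A.Normal ∧ A.FiniteIndex ∧
      (∀ h : H, h ∈ connectedComponent (1 : H) → h ∈ A) ∧
      ∃ ψ : A →* Multiplicative (Fin m → ℤ), Function.Surjective ψ ∧
        ((ψ.ker : Set A) = {a : A | (a : H) ∈ connectedComponent (1 : H)}) := by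
  have hV : IsInducing (fun h : EuclideanIsomGroup n =>
      (h : EuclideanSpace ℝ (Fin n) → EuclideanSpace ℝ (Fin n))) := ⟨rfl⟩
  have hS := isClosed_image_affineRep hV hH
  obtain ⟨𝔥, h𝔥, hloc⟩ := exists_isLieAlgebraOf hS
  have hcc := connectedComponent_one_eq_expSubgroup hV h𝔥 hloc
  obtain ⟨A, hA, hAfin, hle, m, hm, ψ, hψ, hker⟩ :=
    h𝔥.exists_normal_finiteIndex_free_abelian (exists_finite_inv_mul_mem_expSubgroup hS hloc)
  rw [finrank_euclideanSpace_fin] at hm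
  refine ⟨A, m, hm, hA, hAfin, fun h hh => hle ?_, ψ, hψ, ?_⟩
  · rw [hcc] at hh
    exact hh
  · rw [hcc]
    ext a
    exact hker a
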